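/- Fix unit temperature T = 1 and let M_1(v) := (2π)^{−1/2} e^{−v²/2}. Consider the linear BGK equation ∂_t f + v ∂_x f = M_1(v) ∫_ℝ f(x, v', t) dv' − f on the one-dimensional torus 𝕋¹ (with normalized Lebesgue measure dx̃), in the Hilbert space ℋ := L²(𝕋¹ × ℝ; M_1(v)^{−1} dv dx̃). Then there exists a functional e (an entropy functional) defined on densities f with f − M_1 ∈ ℋ, satisfying (1/2) e(f) ≤ ‖f − M_1‖²_ℋ ≤ 4 e(f), such that every solution f(t) of the equation with normalized initial datum f^I (i.e. ∫_{𝕋¹×ℝ} f^I dv dx̃ = 1) and e(f^I) < ∞ satisfies e(f(t)) ≤ e^{−0.5475 t} · e(f^I) for all t ≥ 0. -/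

import Mathlib

open Real Set MeasureTheory

/-- The normalized Maxwellian at unit temperature. -/
noncomputable def M1 (v : ℝ) : ℝ := (Real.sqrt (2 * Real.pi))⁻¹ * Real.exp (-v ^ 2 / 2)

/-- The squared norm of `ℋ = L²(𝕋¹ × ℝ; M₁(v)⁻¹ dv dx̃)`, for functions on
`(0,2π] × ℝ` (with normalized measure in `x`). -/
noncomputable def HnormSq (g : ℝ → ℝ → ℝ) : ℝ :=
  (2 * Real.pi)⁻¹ *
    ∫ p in (Set.Ioc (0:ℝ) (2 * Real.pi)) ×ˢ (Set.univ : Set ℝ), (g p.1 p.2) ^ 2 / M1 p.2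


open Filter Topology
namespace BGK
lemma oneD_upper {a b K : ℝ} {φ G : ℝ → ℝ} (hab : a ≤ b)
    (hcont : ContinuousOn φ (Icc a b)) (hG : IntegrableOn G (Icc a b))
    (hs : ∀ t ∈ Ico a b,
      (∃ᶠ x in 𝓝[>] t, φ x - φ t ≤ (∫ w in t..x, G w) + K * (x - t)) ∨
      (∃ᶠ x in 𝓝[>] t, φ x - φ t ≤ (x - t) * (G t + K))) :
    φ b - φ a ≤ (∫ w in a..b, G w) + K * (b - a) := by
  refine le_of_forall_pos_le_add fun ε εpos => ?_
  rcases exists_lt_lowerSemicontinuous_integral_lt G hG εpos with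
    ⟨G', f_lt_G', G'cont, G'int, G'lt_top, hG'⟩
  set s := {t | φ t - φ a ≤ (∫ u in a..t, (G' u).toReal) + K * (t - a)} ∩ Icc a b
  have s_closed : IsClosed s := by
    have : ContinuousOn (fun t => (φ t - φ a, (∫ u in a..t, (G' u).toReal) + K * (t - a)))
        (Icc a b) := by
      rw [← uIcc_of_le hab] at G'int hcont ⊢
      refine (hcont.sub continuousOn_const).prodMk
        ((intervalIntegral.continuousOn_primitive_interval G'int).add ?_)
      fun_prop
    simp only [s, inter_comm]
    exact this.preimage_isClosed_of_isClosed isClosed_Icc OrderClosedTopology.isClosed_le'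
  have ae_le : ∀ᵐ x : ℝ ∂volume.restrict (Icc a b), G x ≤ (G' x).toReal := by
    filter_upwards [G'lt_top] with x hx
    apply EReal.coe_le_coe_iff.1
    rw [EReal.coe_toReal hx.ne (f_lt_G' x).ne_bot]
    exact (f_lt_G' x).le
  have hii : ∀ {H : ℝ → ℝ} {p q : ℝ}, IntegrableOn H (Icc a b) → a ≤ p → p ≤ q → q ≤ b →
      IntervalIntegrable H volume p q := by
    intro H p q hH h1 h2 h3
    rw [intervalIntegrable_iff_integrableOn_Ioc_of_le h2]
    exact hH.mono_set (Ioc_subset_Icc_self.trans (Icc_subset_Icc h1 h3))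
  have main : Icc a b ⊆ {t | φ t - φ a ≤ (∫ u in a..t, (G' u).toReal) + K * (t - a)} := by
    refine s_closed.Icc_subset_of_forall_exists_gt (by simp) fun t ht v t_lt_v => ?_
    have I4 : ∀ᶠ u in 𝓝[>] t, u ∈ Ioc t (min v b) := Ioc_mem_nhdsGT <| lt_min t_lt_v ht.2.2
    have I3 : ∃ᶠ u in 𝓝[>] t, φ u - φ t ≤ (∫ w in t..u, (G' w).toReal) + K * (u - t) := by
      rcases hs t ht.2 with h | h
      · refine (h.and_eventually I4).mono ?_
        rintro u ⟨h1, h2⟩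
        refine h1.trans (add_le_add ?_ le_rfl)
        have hub : u ≤ b := h2.2.trans (min_le_right _ _)
        apply intervalIntegral.integral_mono_ae_restrict h2.1.le (hii hG ht.2.1 h2.1.le hub)
          (hii G'int ht.2.1 h2.1.le hub)
        exact ae_mono (Measure.restrict_mono (Icc_subset_Icc ht.2.1 hub) le_rfl) ae_le
      · obtain ⟨y, g'_lt_y', y_lt_G'⟩ : ∃ y : ℝ, (G t : EReal) < y ∧ (y : EReal) < G' t :=
          EReal.lt_iff_exists_real_btwn.1 (f_lt_G' t)
        have hGy : G t < y := EReal.coe_lt_coe_iff.1 g'_lt_y'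
        have I1 : ∀ᶠ u in 𝓝[>] t, (u - t) * y ≤ ∫ w in t..u, (G' w).toReal := by
          have B : ∀ᶠ u in 𝓝 t, (y : EReal) < G' u := G'cont.lowerSemicontinuousAt _ _ y_lt_G'
          rcases mem_nhds_iff_exists_Ioo_subset.1 B with ⟨m, M, ⟨hm, hM⟩, H⟩
          have : Ioo t (min M b) ∈ 𝓝[>] t := Ioo_mem_nhdsGT (lt_min hM ht.right.right)
          filter_upwards [this] with u hu
          have I : Icc t u ⊆ Icc a b := Icc_subset_Icc ht.2.1 (hu.2.le.trans (min_le_right _ _))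
          calc
            (u - t) * y = ∫ _ in Icc t u, y := by
              simp only [MeasureTheory.integral_const, MeasurableSet.univ,
                measureReal_restrict_apply,
                univ_inter, hu.left.le, Real.volume_real_Icc_of_le, smul_eq_mul]
            _ ≤ ∫ w in t..u, (G' w).toReal := by
              rw [intervalIntegral.integral_of_le hu.1.le, ← integral_Icc_eq_integral_Ioc]
              apply setIntegral_mono_ae_restrict
              · simp
              · exact IntegrableOn.mono_set G'int I
              · have C1 : ∀ᵐ x : ℝ ∂volume.restrict (Icc t u), G' x < ⊤ :=
                  ae_mono (Measure.restrict_mono I le_rfl) G'lt_top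
                have C2 : ∀ᵐ x : ℝ ∂volume.restrict (Icc t u), x ∈ Icc t u :=
                  ae_restrict_mem measurableSet_Icc
                filter_upwards [C1, C2] with x G'x hx
                apply EReal.coe_le_coe_iff.1
                have : x ∈ Ioo m M := by
                  simp only [hm.trans_le hx.left,
                    (hx.right.trans_lt hu.right).trans_le (min_le_left M b), mem_Ioo, and_self_iff]
                refine (H this).out.le.trans_eq ?_
                exact (EReal.coe_toReal G'x.ne (f_lt_G' x).ne_bot).symm
        refine (h.and_eventually (I1.and I4)).mono ?_
        rintro u ⟨h1, h2, h3⟩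
        have : 0 < u - t := sub_pos.2 h3.1
        nlinarith
    rcases (I3.and_eventually I4).exists with ⟨x, hx, h'x⟩
    refine ⟨x, ?_, Ioc_subset_Ioc le_rfl (min_le_left _ _) h'x⟩
    have hxb : x ≤ b := h'x.2.trans (min_le_right _ _)
    have e1 := intervalIntegral.integral_add_adjacent_intervals
      (hii G'int le_rfl ht.2.1 ht.2.2.le) (hii G'int ht.2.1 h'x.1.le hxb)
    have h1 := ht.1
    simp only [mem_setOf_eq] at h1 ⊢
    rw [← e1]; nlinarith
  have h1 := main (right_mem_Icc.2 hab)
  simp only [mem_setOf_eq] at h1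
  rw [intervalIntegral.integral_of_le hab] at h1 ⊢
  rw [integral_Icc_eq_integral_Ioc, integral_Icc_eq_integral_Ioc] at hG'
  linarith

/-- two-sided version -/
lemma oneD_abs {a b K : ℝ} {φ G : ℝ → ℝ} (hab : a ≤ b)
    (hcont : ContinuousOn φ (Icc a b)) (hG : IntegrableOn G (Icc a b))
    (hs : ∀ t ∈ Ico a b,
      (∃ᶠ x in 𝓝[>] t, |φ x - φ t - ∫ w in t..x, G w| ≤ K * (x - t)) ∨
      (∃ᶠ x in 𝓝[>] t, |φ x - φ t - (x - t) * G t| ≤ K * (x - t))) :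
    |φ b - φ a - ∫ w in a..b, G w| ≤ K * (b - a) := by
  rw [abs_le]; constructor
  · have := oneD_upper (K := K) (φ := fun x => - φ x) (G := fun x => - G x) hab hcont.neg hG.neg
      (fun t ht => by
        rcases hs t ht with h | h
        · left
          refine h.mono fun x hx => ?_
          rw [intervalIntegral.integral_neg]
          linarith [(abs_le.1 hx).1]
        · right
          refine h.mono fun x hx => ?_
          nlinarith [(abs_le.1 hx).1])
    rw [intervalIntegral.integral_neg] at this
    linarith
  · have := oneD_upper (K := K) (φ := φ) (G := G) hab hcont hG
      (fun t ht => by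
        rcases hs t ht with h | h
        · left
          refine h.mono fun x hx => ?_
          linarith [(abs_le.1 hx).2]
        · right
          refine h.mono fun x hx => ?_
          nlinarith [(abs_le.1 hx).2])
    linarith

/-- The set of characteristics with a jump (in direction `θ = ±1`) at a point of `F` is countable. -/
lemma countable_jump {u : ℝ → ℝ → ℝ} {v L κ ℓ θ : ℝ} (hv : v ≠ 0) (hL : 0 ≤ L) (hκ : 0 < κ)
    (hℓ : 0 < ℓ) (hθ : θ = 1 ∨ θ = -1) {F Q : Set (ℝ × ℝ)}
    (H1 : ∀ z ∈ F, ∀ x', (x', z.2) ∈ Q → |u x' z.2 - u z.1 z.2| ≤ L * |x' - z.1|)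
    (H2 : ∀ z ∈ F, ∀ t', (z.1, t') ∈ Q → |u z.1 t' - u z.1 z.2| ≤ L * |t' - z.2|)
    (H3 : ∀ z ∈ F, ∀ z' ∈ F, |u z'.1 z'.2 - u z.1 z.2| ≤ L * (|z'.1 - z.1| + |z'.2 - z.2|)) :
    {y : ℝ | ∃ α, (y + v * α, α) ∈ F ∧ ∀ r ∈ Ioo 0 ℓ, (y + v * (α + θ * r), α + θ * r) ∈ Q ∧
      κ ≤ |u (y + v * (α + θ * r)) (α + θ * r) - u (y + v * α) α|}.Countable := by
  have hv' : 0 < |v| := abs_pos.2 hv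
  obtain ⟨η, hη0, hη1, hη2, hη3⟩ : ∃ η : ℝ, 0 < η ∧ η < ℓ ∧ η / |v| < ℓ ∧
      L * ((3 + |v| + 1 / |v|) * η) < κ := by
    have t1 : Tendsto (fun η : ℝ => η) (𝓝[>] 0) (𝓝 0) := tendsto_id.mono_left nhdsWithin_le_nhds
    have t2 : Tendsto (fun η : ℝ => η / |v|) (𝓝[>] 0) (𝓝 0) := by
      simpa using t1.div_const |v|
    have t3 : Tendsto (fun η : ℝ => L * ((3 + |v| + 1 / |v|) * η)) (𝓝[>] 0) (𝓝 0) := by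
      simpa using (t1.const_mul (3 + |v| + 1 / |v|)).const_mul L
    have t0 : ∀ᶠ η : ℝ in 𝓝[>] 0, 0 < η := self_mem_nhdsWithin
    obtain ⟨η, h⟩ := (t0.and ((t1.eventually_lt_const hℓ).and ((t2.eventually_lt_const hℓ).and
      (t3.eventually_lt_const hκ)))).exists
    exact ⟨η, h.1, h.2.1, h.2.2.1, h.2.2.2⟩
  set S := {y : ℝ | ∃ α, (y + v * α, α) ∈ F ∧ ∀ r ∈ Ioo 0 ℓ,
    (y + v * (α + θ * r), α + θ * r) ∈ Q ∧
      κ ≤ |u (y + v * (α + θ * r)) (α + θ * r) - u (y + v * α) α|} with hS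
  have hex : ∀ y : ℝ, ∃ α, y ∈ S → ((y + v * α, α) ∈ F ∧ ∀ r ∈ Ioo 0 ℓ,
      (y + v * (α + θ * r), α + θ * r) ∈ Q ∧
      κ ≤ |u (y + v * (α + θ * r)) (α + θ * r) - u (y + v * α) α|) := by
    intro y
    by_cases hy : y ∈ S
    · obtain ⟨α, h⟩ := hy
      exact ⟨α, fun _ => h⟩
    · exact ⟨0, fun h => (hy h).elim⟩
  choose A hA using hex
  have hθ2 : θ * θ = 1 := by rcases hθ with h | h <;> rw [h] <;> norm_num
  have hθa : |θ| = 1 := by rcases hθ with h | h <;> rw [h] <;> norm_num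
  -- the key geometric facts
  have key1 : ∀ y ∈ S, ∀ y' ∈ S, |y' - y| < η → |A y' - A y| < η → 0 < θ * (A y' - A y) →
      False := by
    intro y hy y' hy' h1 h2 h3
    obtain ⟨hF, hr⟩ := hA y hy
    obtain ⟨hF', -⟩ := hA y' hy'
    have e1 : A y + θ * (θ * (A y' - A y)) = A y' := by
      rw [← mul_assoc, hθ2]; ring
    have e2 : θ * (A y' - A y) < ℓ := by
      calc θ * (A y' - A y) ≤ |θ * (A y' - A y)| := le_abs_self _
        _ = |A y' - A y| := by rw [abs_mul, hθa, one_mul]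
        _ < ℓ := h2.trans hη1
    obtain ⟨hQ, hk⟩ := hr _ ⟨h3, e2⟩
    rw [e1] at hQ hk
    have b1 := H1 _ hF' _ hQ
    have b3 := H3 _ hF _ hF'
    simp only at b1 b3
    have c1 : |y + v * A y' - (y' + v * A y')| < η := by
      rw [show y + v * A y' - (y' + v * A y') = -(y' - y) by ring, abs_neg]; exact h1
    have c2 : |y' + v * A y' - (y + v * A y)| ≤ η + |v| * η := by
      rw [show y' + v * A y' - (y + v * A y) = (y' - y) + v * (A y' - A y) by ring]
      refine (abs_add_le _ _).trans (add_le_add h1.le ?_)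
      rw [abs_mul]
      exact mul_le_mul_of_nonneg_left h2.le hv'.le
    have c3 : |u (y + v * A y') (A y') - u (y + v * A y) (A y)| ≤ L * ((3 + |v|) * η) := by
      calc _ ≤ |u (y + v * A y') (A y') - u (y' + v * A y') (A y')| +
            |u (y' + v * A y') (A y') - u (y + v * A y) (A y)| := abs_sub_le _ _ _
        _ ≤ L * η + L * ((η + |v| * η) + η) := by
            refine add_le_add (b1.trans ?_) (b3.trans ?_)
            · exact mul_le_mul_of_nonneg_left c1.le hL
            · exact mul_le_mul_of_nonneg_left (add_le_add c2 h2.le) hL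
        _ = L * ((3 + |v|) * η) := by ring
    have c4 : L * ((3 + |v|) * η) ≤ L * ((3 + |v| + 1 / |v|) * η) := by
      refine mul_le_mul_of_nonneg_left (mul_le_mul_of_nonneg_right ?_ hη0.le) hL
      have : 0 < 1 / |v| := by positivity
      linarith
    linarith
  have key2 : ∀ y ∈ S, ∀ y' ∈ S, |y' - y| < η → A y' = A y → 0 < θ * ((y' - y) / v) → False := by
    intro y hy y' hy' h1 h2 h3
    obtain ⟨hF, hr⟩ := hA y hy
    obtain ⟨hF', -⟩ := hA y' hy'
    rw [h2] at hF'
    have e0 : |(y' - y) / v| < η / |v| := by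
      rw [abs_div]; exact div_lt_div_of_pos_right h1 hv'
    have e1 : A y + θ * (θ * ((y' - y) / v)) = A y + (y' - y) / v := by
      rw [← mul_assoc, hθ2]; ring
    have e2 : θ * ((y' - y) / v) < ℓ := by
      calc θ * ((y' - y) / v) ≤ |θ * ((y' - y) / v)| := le_abs_self _
        _ = |(y' - y) / v| := by rw [abs_mul, hθa, one_mul]
        _ < ℓ := e0.trans hη2
    obtain ⟨hQ, hk⟩ := hr _ ⟨h3, e2⟩
    rw [e1] at hQ hk
    have e3 : y + v * (A y + (y' - y) / v) = y' + v * A y := by field_simp; ring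
    rw [e3] at hQ hk
    have b1 := H2 _ hF' _ hQ
    have b3 := H3 _ hF _ hF'
    simp only at b1 b3
    have c1 : |A y + (y' - y) / v - A y| ≤ η / |v| := by
      rw [add_sub_cancel_left]; exact e0.le
    have c2 : |y' + v * A y - (y + v * A y)| + |A y - A y| ≤ η := by
      simp only [sub_self, abs_zero, add_zero, add_sub_add_right_eq_sub]; exact h1.le
    have c3 : |u (y' + v * A y) (A y + (y' - y) / v) - u (y + v * A y) (A y)|
        ≤ L * ((1 + 1 / |v|) * η) := by
      calc _ ≤ |u (y' + v * A y) (A y + (y' - y) / v) - u (y' + v * A y) (A y)| +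
            |u (y' + v * A y) (A y) - u (y + v * A y) (A y)| := abs_sub_le _ _ _
        _ ≤ L * (η / |v|) + L * η := by
            refine add_le_add (b1.trans ?_) (b3.trans ?_)
            · exact mul_le_mul_of_nonneg_left c1 hL
            · exact mul_le_mul_of_nonneg_left c2 hL
        _ = L * ((1 + 1 / |v|) * η) := by ring
    have c4 : L * ((1 + 1 / |v|) * η) ≤ L * ((3 + |v| + 1 / |v|) * η) := by
      refine mul_le_mul_of_nonneg_left (mul_le_mul_of_nonneg_right ?_ hη0.le) hL
      linarith
    linarith
  have cell : ∀ p q : ℝ, ⌊p / η⌋ = ⌊q / η⌋ → |p - q| < η := by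
    intro p q h
    have := Int.abs_sub_lt_one_of_floor_eq_floor h
    rw [← sub_div, abs_div, abs_of_pos hη0, div_lt_one hη0] at this
    exact this
  have hinj : InjOn (fun y : ℝ => ((⌊y / η⌋ : ℤ), (⌊A y / η⌋ : ℤ))) S := by
    intro y hy y' hy' he
    simp only [Prod.mk.injEq] at he
    have d1 := cell _ _ he.1
    have d2 := cell _ _ he.2
    have d1' : |y' - y| < η := by rw [abs_sub_comm]; exact d1
    have d2' : |A y' - A y| < η := by rw [abs_sub_comm]; exact d2
    have hAe : A y' = A y := by
      by_contra hne
      have hne' : θ * (A y' - A y) ≠ 0 := by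
        refine mul_ne_zero ?_ (sub_ne_zero.2 hne)
        intro h0; rw [h0] at hθ2; norm_num at hθ2
      rcases lt_or_gt_of_ne hne' with h | h
      · exact key1 y' hy' y hy d1 d2 (by linarith)
      · exact key1 y hy y' hy' d1' d2' h
    by_contra hne
    have hne' : θ * ((y' - y) / v) ≠ 0 := by
      refine mul_ne_zero ?_ (div_ne_zero (sub_ne_zero.2 (Ne.symm hne)) hv)
      intro h0; rw [h0] at hθ2; norm_num at hθ2
    rcases lt_or_gt_of_ne hne' with h | h
    · refine key2 y' hy' y hy d1 hAe.symm ?_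
      rw [show (y - y') / v = - ((y' - y) / v) by ring]; linarith
    · exact key2 y hy y' hy' d1' hAe h
  exact MapsTo.countable_of_injOn (mapsTo_image _ _) hinj (to_countable _)

lemma line_lemma {φ G : ℝ → ℝ} {s0 s1 c ε' K : ℝ} {F : Set ℝ} (hs : s0 ≤ s1)
    (hF : IsClosed F) (hG : IntegrableOn G (Icc s0 s1)) (hε : 0 ≤ ε') (hK : 2 * ε' ≤ K)
    (h1 : ∀ τ ∈ F, τ ∈ Icc s0 s1 → |G τ - c| ≤ ε')
    (h2 : ∀ τ ∈ F, τ ∈ Icc s0 s1 → ∀ σ ∈ F, σ ∈ Icc s0 s1 →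
      |φ σ - φ τ - c * (σ - τ)| ≤ ε' * |σ - τ|)
    (h3 : ∀ τ σ, s0 ≤ τ → τ ≤ σ → σ ≤ s1 → (∀ r ∈ Icc τ σ, r ∉ F) →
      |φ σ - φ τ - ∫ w in τ..σ, G w| ≤ K * (σ - τ))
    (h4 : ∀ τ σ, s0 ≤ τ → τ < σ → σ ≤ s1 → τ ∈ F → (∀ r ∈ Ioc τ σ, r ∉ F) →
      Tendsto φ (𝓝[>] τ) (𝓝 (φ τ)))
    (h5 : ∀ τ σ, s0 ≤ τ → τ < σ → σ ≤ s1 → σ ∈ F → (∀ r ∈ Ico τ σ, r ∉ F) →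
      Tendsto φ (𝓝[<] σ) (𝓝 (φ σ))) :
    |φ s1 - φ s0 - ∫ w in s0..s1, G w| ≤ K * (s1 - s0) := by
  have hii : ∀ {p q : ℝ}, s0 ≤ p → p ≤ q → q ≤ s1 → IntervalIntegrable G volume p q := by
    intro p q h1 h2 h3
    rw [intervalIntegrable_iff_integrableOn_Ioc_of_le h2]
    exact hG.mono_set (Ioc_subset_Icc_self.trans (Icc_subset_Icc h1 h3))
  set P : ℝ → ℝ := fun σ => ∫ w in s0..σ, G w with hP
  have hPd : ∀ τ σ, s0 ≤ τ → τ ≤ σ → σ ≤ s1 → ∫ w in τ..σ, G w = P σ - P τ := by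
    intro τ σ a1 a2 a3
    have := intervalIntegral.integral_add_adjacent_intervals
      (hii le_rfl a1 (a2.trans a3)) (hii a1 a2 a3)
    simp only [hP]; linarith
  have hPc : ContinuousOn P (Icc s0 s1) := by
    rw [← uIcc_of_le hs] at hG ⊢
    exact intervalIntegral.continuousOn_primitive_interval hG
  have hGa : IntegrableOn (fun w => |G w|) (Icc s0 s1) := hG.abs
  have hiia : ∀ {p q : ℝ}, s0 ≤ p → p ≤ q → q ≤ s1 →
      IntervalIntegrable (fun w => |G w|) volume p q := by
    intro p q h1 h2 h3
    exact (hii h1 h2 h3).abs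
  have hKn : 0 ≤ K := by linarith
  have R4 : ∀ τ σ, s0 ≤ τ → τ < σ → σ ≤ s1 → (∀ r ∈ Ioc τ σ, r ∉ F) →
      |φ σ - φ τ - ∫ w in τ..σ, G w| ≤ K * (σ - τ) := by
    intro τ σ a1 a2 a3 a4
    by_cases hτ : τ ∈ F
    · have t1 := h4 τ σ a1 a2 a3 hτ a4
      have t2 : Tendsto P (𝓝[>] τ) (𝓝 (P τ)) := by
        have := (hPc τ ⟨a1, a2.le.trans a3⟩).mono
          (Icc_subset_Icc a1 a3 |> fun h => (Ioc_subset_Icc_self.trans h))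
        have h6 : Tendsto P (𝓝[Ioc τ σ] τ) (𝓝 (P τ)) := this
        rwa [nhdsWithin_Ioc_eq_nhdsGT a2] at h6
      have t3 : Tendsto (fun r : ℝ => r) (𝓝[>] τ) (𝓝 τ) :=
        tendsto_id.mono_left nhdsWithin_le_nhds
      rw [hPd τ σ a1 a2.le a3]
      refine le_of_tendsto_of_tendsto
        ((((tendsto_const_nhds (x := φ σ)).sub t1).sub ((tendsto_const_nhds (x := P σ)).sub t2)).abs)
        (((tendsto_const_nhds (x := σ)).sub t3).const_mul K) ?_
      filter_upwards [Ioc_mem_nhdsGT a2] with r hr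
      have := h3 r σ (a1.trans hr.1.le) hr.2 a3 (fun q hq => a4 q ⟨hr.1.trans_le hq.1, hq.2⟩)
      rwa [hPd r σ (a1.trans hr.1.le) hr.2 a3] at this
    · refine h3 τ σ a1 a2.le a3 fun r hr => ?_
      rcases hr.1.eq_or_lt with h | h
      · rwa [← h]
      · exact a4 r ⟨h, hr.2⟩
  have R5 : ∀ τ σ, s0 ≤ τ → τ < σ → σ ≤ s1 → (∀ r ∈ Ico τ σ, r ∉ F) →
      |φ σ - φ τ - ∫ w in τ..σ, G w| ≤ K * (σ - τ) := by
    intro τ σ a1 a2 a3 a4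
    by_cases hσ : σ ∈ F
    · have t1 := h5 τ σ a1 a2 a3 hσ a4
      have t2 : Tendsto P (𝓝[<] σ) (𝓝 (P σ)) := by
        have := (hPc σ ⟨a1.trans a2.le, a3⟩).mono
          (Icc_subset_Icc a1 a3 |> fun h => (Ico_subset_Icc_self.trans h))
        have h6 : Tendsto P (𝓝[Ico τ σ] σ) (𝓝 (P σ)) := this
        rwa [nhdsWithin_Ico_eq_nhdsLT a2] at h6
      have t3 : Tendsto (fun r : ℝ => r) (𝓝[<] σ) (𝓝 σ) :=
        tendsto_id.mono_left nhdsWithin_le_nhds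
      rw [hPd τ σ a1 a2.le a3]
      refine le_of_tendsto_of_tendsto
        (((t1.sub (tendsto_const_nhds (x := φ τ))).sub (t2.sub (tendsto_const_nhds (x := P τ)))).abs)
        ((t3.sub (tendsto_const_nhds (x := τ))).const_mul K) ?_
      filter_upwards [Ico_mem_nhdsLT a2] with r hr
      have := h3 τ r a1 hr.1 (hr.2.le.trans a3) (fun q hq => a4 q ⟨hq.1, hq.2.trans_lt hr.2⟩)
      rwa [hPd τ r a1 hr.1 (hr.2.le.trans a3)] at this
    · refine h3 τ σ a1 a2.le a3 fun r hr => ?_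
      rcases hr.2.eq_or_lt with h | h
      · rwa [h]
      · exact a4 r ⟨hr.1, h⟩
  -- modulus of continuity
  set C := K + |c| + ε' with hC
  have hCn : 0 ≤ C := by positivity
  set R : ℝ → ℝ := fun σ => C * σ + ∫ w in s0..σ, |G w| with hR
  have hRd : ∀ τ σ, s0 ≤ τ → τ ≤ σ → σ ≤ s1 →
      R σ - R τ = C * (σ - τ) + ∫ w in τ..σ, |G w| := by
    intro τ σ a1 a2 a3
    have := intervalIntegral.integral_add_adjacent_intervals
      (hiia le_rfl a1 (a2.trans a3)) (hiia a1 a2 a3)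
    simp only [hR]; linarith
  have hRc : ContinuousOn R (Icc s0 s1) := by
    refine ContinuousOn.add (by fun_prop) ?_
    rw [← uIcc_of_le hs] at hGa ⊢
    exact intervalIntegral.continuousOn_primitive_interval hGa
  have piece : ∀ τ σ, s0 ≤ τ → τ ≤ σ → σ ≤ s1 →
      |φ σ - φ τ - ∫ w in τ..σ, G w| ≤ K * (σ - τ) → |φ σ - φ τ| ≤ R σ - R τ := by
    intro τ σ a1 a2 a3 a4
    rw [hRd τ σ a1 a2 a3]
    have b1 := intervalIntegral.abs_integral_le_integral_abs (f := G) (μ := volume) a2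
    have b2 : |φ σ - φ τ| ≤ |φ σ - φ τ - ∫ w in τ..σ, G w| + |∫ w in τ..σ, G w| := by
      have := abs_add_le (φ σ - φ τ - ∫ w in τ..σ, G w) (∫ w in τ..σ, G w)
      simpa using this
    have : K * (σ - τ) ≤ C * (σ - τ) :=
      mul_le_mul_of_nonneg_right (by rw [hC]; linarith [abs_nonneg c]) (by linarith)
    linarith
  have Tm : ∀ τ σ, s0 ≤ τ → τ ≤ σ → σ ≤ s1 → |φ σ - φ τ| ≤ R σ - R τ := by
    intro τ σ a1 a2 a3
    by_cases hne : (Icc τ σ ∩ F).Nonempty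
    · have hcpt : IsCompact (Icc τ σ ∩ F) := isCompact_Icc.inter_right hF
      obtain ⟨hα1, hα2⟩ := hcpt.sInf_mem hne
      obtain ⟨hβ1, hβ2⟩ := hcpt.sSup_mem hne
      set α := sInf (Icc τ σ ∩ F)
      set β := sSup (Icc τ σ ∩ F)
      have hαβ : α ≤ β := csInf_le hcpt.bddBelow ⟨hβ1, hβ2⟩
      have p1 : |φ α - φ τ| ≤ R α - R τ := by
        rcases hα1.1.eq_or_lt with h | h
        · rw [← h]; simp
        · refine piece τ α a1 hα1.1 (hα1.2.trans a3) (R5 τ α a1 h (hα1.2.trans a3) ?_)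
          intro r hr hrF
          exact absurd (csInf_le hcpt.bddBelow (⟨⟨hr.1, hr.2.le.trans hα1.2⟩, hrF⟩ :
            r ∈ Icc τ σ ∩ F)) (not_le.2 hr.2)
      have p3 : |φ σ - φ β| ≤ R σ - R β := by
        rcases hβ1.2.eq_or_lt with h | h
        · rw [← h]; simp
        · refine piece β σ (a1.trans hβ1.1) hβ1.2 a3 (R4 β σ (a1.trans hβ1.1) h a3 ?_)
          intro r hr hrF
          exact absurd (le_csSup hcpt.bddAbove (⟨⟨hβ1.1.trans hr.1.le, hr.2⟩, hrF⟩ :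
            r ∈ Icc τ σ ∩ F)) (not_le.2 hr.1)
      have p2 : |φ β - φ α| ≤ R β - R α := by
        rw [hRd α β (a1.trans hα1.1) hαβ (hβ1.2.trans a3)]
        have b1 := h2 α hα2 ⟨a1.trans hα1.1, hα1.2.trans a3⟩ β hβ2 ⟨a1.trans hβ1.1, hβ1.2.trans a3⟩
        have b2 : 0 ≤ ∫ w in α..β, |G w| :=
          intervalIntegral.integral_nonneg hαβ (fun _ _ => abs_nonneg _)
        have b3 : |φ β - φ α| ≤ |φ β - φ α - c * (β - α)| + |c * (β - α)| := by
          have := abs_add_le (φ β - φ α - c * (β - α)) (c * (β - α))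
          simpa using this
        rw [abs_mul, abs_of_nonneg (sub_nonneg.2 hαβ)] at b3
        rw [abs_of_nonneg (sub_nonneg.2 hαβ)] at b1
        rw [hC]
        nlinarith [mul_nonneg hKn (sub_nonneg.2 hαβ)]
      have q1 := abs_sub_le (φ σ) (φ β) (φ α)
      have q2 := abs_sub_le (φ σ) (φ α) (φ τ)
      linarith
    · refine piece τ σ a1 a2 a3 (h3 τ σ a1 a2 a3 fun r hr hrF => hne ⟨r, hr, hrF⟩)
  have hcont : ContinuousOn φ (Icc s0 s1) := by
    intro τ hτ
    have hd : ∀ σ ∈ Icc s0 s1, dist (φ σ) (φ τ) ≤ dist (R σ) (R τ) := by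
      intro σ hσ
      rw [Real.dist_eq, Real.dist_eq]
      rcases le_total τ σ with h | h
      · exact (Tm τ σ hτ.1 h hσ.2).trans (le_abs_self _)
      · rw [abs_sub_comm, abs_sub_comm (R σ)]
        exact (Tm σ τ hσ.1 h hτ.2).trans (le_abs_self _)
    have h6 := tendsto_iff_dist_tendsto_zero.1 (hRc τ hτ)
    refine tendsto_iff_dist_tendsto_zero.2 (squeeze_zero' (Eventually.of_forall fun _ => dist_nonneg) ?_ h6)
    filter_upwards [self_mem_nhdsWithin] with σ hσ using hd σ hσ
  refine oneD_abs hs hcont hG fun t ht => ?_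
  by_cases hfr : t ∈ F ∧ ∃ᶠ x in 𝓝[>] t, x ∈ F
  · right
    obtain ⟨htF, hfr⟩ := hfr
    refine (hfr.and_eventually (Ioc_mem_nhdsGT ht.2)).mono ?_
    rintro x ⟨hxF, hx⟩
    have b1 := h2 t htF ⟨ht.1, ht.2.le⟩ x hxF ⟨ht.1.trans hx.1.le, hx.2⟩
    have b2 := h1 t htF ⟨ht.1, ht.2.le⟩
    have hp : 0 < x - t := sub_pos.2 hx.1
    rw [abs_of_pos hp] at b1
    have b3 : |(x - t) * (G t - c)| ≤ ε' * (x - t) := by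
      rw [abs_mul, abs_of_pos hp]; nlinarith
    have b4 : |φ x - φ t - (x - t) * G t| ≤
        |φ x - φ t - c * (x - t)| + |(x - t) * (G t - c)| := by
      have := abs_sub (φ x - φ t - c * (x - t)) ((x - t) * (G t - c))
      rw [show φ x - φ t - c * (x - t) - (x - t) * (G t - c) = φ x - φ t - (x - t) * G t by ring]
        at this
      exact this
    nlinarith
  · left
    have hev : ∀ᶠ x in 𝓝[>] t, x ∉ F := by
      by_cases htF : t ∈ F
      · have : ¬ ∃ᶠ x in 𝓝[>] t, x ∈ F := fun h => hfr ⟨htF, h⟩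
        exact not_frequently.1 this
      · exact nhdsWithin_le_nhds (hF.isOpen_compl.mem_nhds htF)
    obtain ⟨d, hd, hsub⟩ := (mem_nhdsGT_iff_exists_Ioc_subset).1 hev
    refine Eventually.frequently ?_
    filter_upwards [Ioc_mem_nhdsGT (lt_min (show t < d from hd) ht.2)] with x hx
    refine R4 t x ht.1 hx.1 (hx.2.trans (min_le_right _ _)) fun r hr => ?_
    exact hsub ⟨hr.1, hr.2.trans (hx.2.trans (min_le_left _ _))⟩


def GoodSet (u G : ℝ → ℝ → ℝ) (v a b K : ℝ) (V : Set (ℝ × ℝ)) : Prop :=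
  ∀ᵐ y : ℝ, ∀ s s' : ℝ, a ≤ s → s ≤ s' → s' ≤ b → (∀ τ ∈ Icc s s', (y + v * τ, τ) ∈ V) →
    |u (y + v * s') s' - u (y + v * s) s - ∫ w in s..s', G y w| ≤ K * (s' - s)

lemma goodSet_sUnion {u G : ℝ → ℝ → ℝ} {v a b K : ℝ} {S : Set (Set (ℝ × ℝ))}
    (hS : S.Countable) (hopen : ∀ V ∈ S, IsOpen V) (hgood : ∀ V ∈ S, GoodSet u G v a b K V)
    (hG : ∀ᵐ y : ℝ, IntegrableOn (G y) (Icc a b)) : GoodSet u G v a b K (⋃₀ S) := by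
  have h1 : ∀ᵐ y : ℝ, ∀ V ∈ S, ∀ s s' : ℝ, a ≤ s → s ≤ s' → s' ≤ b →
      (∀ τ ∈ Icc s s', (y + v * τ, τ) ∈ V) →
      |u (y + v * s') s' - u (y + v * s) s - ∫ w in s..s', G y w| ≤ K * (s' - s) :=
    (ae_ball_iff hS).2 hgood
  filter_upwards [h1, hG] with y hy hGy s s' has hss hsb hmem
  have hGs : IntegrableOn (G y) (Icc s s') := hGy.mono_set (Icc_subset_Icc has hsb)
  -- local Lipschitz
  have hloc : ∀ t ∈ Icc s s', ∀ᶠ x in 𝓝[Icc s s'] t,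
      |u (y + v * x) x - u (y + v * t) t - ∫ w in t..x, G y w| ≤ K * |x - t| := by
    intro t ht
    obtain ⟨V, hVS, hV⟩ := hmem t ht
    have hc : Continuous fun τ : ℝ => (y + v * τ, τ) := by fun_prop
    have ho : IsOpen ((fun τ : ℝ => (y + v * τ, τ)) ⁻¹' V) := (hopen V hVS).preimage hc
    obtain ⟨ε, hε, hb⟩ := Metric.isOpen_iff.1 ho t hV
    have : ∀ᶠ x in 𝓝[Icc s s'] t, x ∈ Metric.ball t ε :=
      mem_nhdsWithin_of_mem_nhds (Metric.ball_mem_nhds t hε)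
    filter_upwards [this, self_mem_nhdsWithin] with x hx hxI
    have hconv : ∀ τ ∈ uIcc t x, (y + v * τ, τ) ∈ V := by
      intro τ hτ
      apply hb
      have := abs_sub_left_of_mem_uIcc hτ
      rw [Metric.mem_ball, Real.dist_eq] at hx ⊢
      exact lt_of_le_of_lt this hx
    rcases le_total t x with h | h
    · rw [uIcc_of_le h] at hconv
      have := hy V hVS t x (has.trans ht.1) h (hxI.2.trans hsb) hconv
      rwa [abs_of_nonneg (sub_nonneg.2 h)]
    · rw [uIcc_of_ge h] at hconv
      have := hy V hVS x t (has.trans hxI.1) h (ht.2.trans hsb) hconv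
      rw [abs_sub_comm x t, abs_of_nonneg (sub_nonneg.2 h), intervalIntegral.integral_symm]
      rw [← abs_neg]
      convert this using 2
      ring
  have hprim : ContinuousOn (fun x => ∫ w in s..x, G y w) (Icc s s') := by
    have := intervalIntegral.continuousOn_primitive_interval (μ := volume) (f := G y) (a := s) (b := s')
      (by rwa [uIcc_of_le hss])
    rwa [uIcc_of_le hss] at this
  have hsub : ∀ t ∈ Icc s s', ∀ x ∈ Icc s s', ∫ w in t..x, G y w =
      (∫ w in s..x, G y w) - ∫ w in s..t, G y w := by
    intro t ht x hx
    rw [intervalIntegral.integral_interval_sub_left]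
    · exact (intervalIntegrable_iff_integrableOn_Icc_of_le hx.1).2
        (hGs.mono_set (Icc_subset_Icc le_rfl hx.2))
    · exact (intervalIntegrable_iff_integrableOn_Icc_of_le ht.1).2
        (hGs.mono_set (Icc_subset_Icc le_rfl ht.2))
  have hcont : ContinuousOn (fun x => u (y + v * x) x) (Icc s s') := by
    intro t ht
    have e1 : Tendsto (fun x => (u (y + v * x) x - u (y + v * t) t - ∫ w in t..x, G y w))
        (𝓝[Icc s s'] t) (𝓝 0) := by
      apply squeeze_zero_norm' (a := fun x => K * |x - t|)
      · simpa using hloc t ht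
      · have : Continuous fun x => K * |x - t| := by fun_prop
        have := (this.tendsto t).mono_left (nhdsWithin_le_nhds (s := Icc s s'))
        simpa using this
    have e2 : Tendsto (fun x => ∫ w in t..x, G y w) (𝓝[Icc s s'] t) (𝓝 0) := by
      have := (hprim t ht).tendsto.sub_const (∫ w in s..t, G y w)
      rw [sub_self] at this
      refine this.congr' ?_
      filter_upwards [self_mem_nhdsWithin] with x hx
      rw [hsub t ht x hx]
    have e3 := (e1.add e2).add_const (u (y + v * t) t)
    simp only [zero_add, add_zero] at e3
    refine e3.congr fun x => by ring
  apply oneD_abs hss hcont hGs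
  intro t ht
  left
  have h2 := hloc t (Ico_subset_Icc_self ht)
  have hle : 𝓝[>] t ≤ 𝓝[Icc s s'] t := by
    rw [← nhdsWithin_Ioc_eq_nhdsGT ht.2]
    exact nhdsWithin_mono _ fun x hx => ⟨ht.1.trans hx.1.le, hx.2⟩
  refine Filter.Eventually.frequently ?_
  filter_upwards [hle h2, self_mem_nhdsWithin] with x hx hx'
  have : |x - t| = x - t := abs_of_pos (sub_pos.2 hx')
  rwa [this] at hx

def CrossSet (u : ℝ → ℝ → ℝ) (a b ε δ q1 q2 : ℝ) : Set (ℝ × ℝ) :=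
  {z | z.2 ∈ Icc a b ∧ (∀ x', |x' - z.1| < δ →
      |u x' z.2 - u z.1 z.2 - q1 * (x' - z.1)| ≤ ε * |x' - z.1|) ∧
    (∀ t' ∈ Icc a b, |t' - z.2| < δ →
      |u z.1 t' - u z.1 z.2 - q2 * (t' - z.2)| ≤ ε * |t' - z.2|)}

lemma crossSet_isClosed {u : ℝ → ℝ → ℝ} {a b ε δ q1 q2 : ℝ} (hδ : 0 < δ)
    (hx : ∀ t ∈ Icc a b, Continuous fun x => u x t)
    (ht : ∀ x, ContinuousOn (fun t => u x t) (Icc a b)) :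
    IsClosed (CrossSet u a b ε δ q1 q2) := by
  apply IsSeqClosed.isClosed
  intro w z hw hlim
  have l1 : Tendsto (fun j => (w j).1) atTop (𝓝 z.1) := (continuous_fst.tendsto z).comp hlim
  have l2 : Tendsto (fun j => (w j).2) atTop (𝓝 z.2) := (continuous_snd.tendsto z).comp hlim
  have hz2 : z.2 ∈ Icc a b := isClosed_Icc.mem_of_tendsto l2 (Eventually.of_forall fun j => (hw j).1)
  have l2' : Tendsto (fun j => (w j).2) atTop (𝓝[Icc a b] z.2) :=
    tendsto_nhdsWithin_iff.2 ⟨l2, Eventually.of_forall fun j => (hw j).1⟩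
  have vert : ∀ x, Tendsto (fun j => u x (w j).2) atTop (𝓝 (u x z.2)) :=
    fun x => (ht x z.2 hz2).tendsto.comp l2'
  have horiz : ∀ t ∈ Icc a b, Tendsto (fun j => u (w j).1 t) atTop (𝓝 (u z.1 t)) :=
    fun t h => ((hx t h).tendsto z.1).comp l1
  -- u (w j) → u z
  have hu : Tendsto (fun j => u (w j).1 (w j).2) atTop (𝓝 (u z.1 z.2)) := by
    have hev : ∀ᶠ j in atTop, |z.1 - (w j).1| < δ := by
      have : Tendsto (fun j => |z.1 - (w j).1|) atTop (𝓝 0) := by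
        have := (tendsto_const_nhds (x := z.1)).sub l1
        simpa using this.abs
      exact this.eventually (gt_mem_nhds hδ)
    have e1 : Tendsto (fun j => u z.1 (w j).2 - u (w j).1 (w j).2 - q1 * (z.1 - (w j).1)) atTop (𝓝 0) := by
      apply squeeze_zero_norm' (a := fun j => ε * |z.1 - (w j).1|)
      · filter_upwards [hev] with j hj
        exact (hw j).2.1 z.1 hj
      · have := (tendsto_const_nhds (x := z.1)).sub l1
        simpa using this.abs.const_mul ε
    have e2 : Tendsto (fun j => q1 * (z.1 - (w j).1)) atTop (𝓝 0) := by
      have := (tendsto_const_nhds (x := z.1)).sub l1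
      simpa using this.const_mul q1
    have e3 := (vert z.1).sub (e1.add e2)
    simp only [add_zero, sub_zero] at e3
    exact e3.congr fun j => by ring
  refine ⟨hz2, ?_, ?_⟩
  · intro x' hx'
    have hl : Tendsto (fun j => |x' - (w j).1|) atTop (𝓝 |x' - z.1|) := (l1.const_sub x').abs
    refine le_of_tendsto_of_tendsto
      ((((vert x').sub hu).sub ((l1.const_sub x').const_mul q1)).abs) (hl.const_mul ε) ?_
    filter_upwards [hl.eventually (gt_mem_nhds hx')] with j hj
    exact (hw j).2.1 x' hj
  · intro t' ht' hd
    have hl : Tendsto (fun j => |t' - (w j).2|) atTop (𝓝 |t' - z.2|) := (l2.const_sub t').abs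
    refine le_of_tendsto_of_tendsto
      ((((horiz t' ht').sub hu).sub ((l2.const_sub t').const_mul q2)).abs) (hl.const_mul ε) ?_
    filter_upwards [hl.eventually (gt_mem_nhds hd)] with j hj
    exact (hw j).2.2 t' ht' hj

lemma cross_aux {f : ℝ → ℝ} {f' x ε : ℝ} {s : Set ℝ} (hf : HasDerivWithinAt f f' s x)
    (hε : 0 < ε) : ∃ q : ℚ, ∃ n : ℕ, ∀ m ≥ n, ∀ y ∈ s, |y - x| < 1 / ((m : ℝ) + 1) →
      |f y - f x - q * (y - x)| ≤ ε * |y - x| := by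
  obtain ⟨q, hq1, hq2⟩ := exists_rat_btwn (show f' - ε / 2 < f' + ε / 2 by linarith)
  have h := (hasDerivWithinAt_iff_isLittleO.1 hf).def (half_pos hε)
  rw [eventually_nhdsWithin_iff, Metric.eventually_nhds_iff] at h
  obtain ⟨d, hd, h⟩ := h
  obtain ⟨n, hn⟩ := exists_nat_one_div_lt hd
  refine ⟨q, n, fun m hm y hy hyx => ?_⟩
  have h1 : 1 / ((m : ℝ) + 1) ≤ 1 / ((n : ℝ) + 1) := by
    apply one_div_le_one_div_of_le (by positivity)
    have : (n : ℝ) ≤ m := by exact_mod_cast hm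
    linarith
  have h2 := h (y := y) (by rw [Real.dist_eq]; linarith) hy
  simp only [Real.norm_eq_abs, smul_eq_mul] at h2
  have : f y - f x - q * (y - x) = (f y - f x - (y - x) * f') + (f' - q) * (y - x) := by ring
  rw [this]
  have h3 : |f' - q| ≤ ε / 2 := abs_le.2 ⟨by linarith, by linarith⟩
  calc _ ≤ _ := abs_add_le _ _
    _ ≤ ε / 2 * |y - x| + ε / 2 * |y - x| := by
        rw [abs_mul]; gcongr
    _ = _ := by ring

lemma cross_bound {f : ℝ → ℝ} {f' x ε q δ : ℝ} {s : Set ℝ} (hf : HasDerivWithinAt f f' s x)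
    (hs : UniqueDiffWithinAt ℝ s x) (hδ : 0 < δ)
    (h : ∀ y ∈ s, |y - x| < δ → |f y - f x - q * (y - x)| ≤ ε * |y - x|) : |f' - q| ≤ ε := by
  have hne : (𝓝[s \ {x}] x).NeBot := by
    have := uniqueDiffWithinAt_iff_accPt.1 hs
    rwa [accPt_principal_iff_nhdsWithin] at this
  have h1 := (hasDerivWithinAt_iff_tendsto_slope.1 hf).sub_const q
  refine le_of_tendsto h1.abs ?_
  have hb : ∀ᶠ y in 𝓝[s \ {x}] x, y ∈ Metric.ball x δ :=
    mem_nhdsWithin_of_mem_nhds (Metric.ball_mem_nhds x hδ)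
  filter_upwards [hb, self_mem_nhdsWithin] with y hy hys
  rw [Metric.mem_ball, Real.dist_eq] at hy
  have hyx : y - x ≠ 0 := sub_ne_zero.2 fun h => hys.2 (by simp [h])
  have := h y hys.1 hy
  rw [slope_def_field]
  have e : (f y - f x) / (y - x) - q = (f y - f x - q * (y - x)) / (y - x) := by field_simp
  rw [e, abs_div, div_le_iff₀ (abs_pos.2 hyx)]
  exact this

lemma exists_right_lim {φ G : ℝ → ℝ} {τ σ K : ℝ} (hτσ : τ < σ) (hK : 0 ≤ K)
    (hG : IntegrableOn G (Icc τ σ))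
    (h : ∀ r r', τ < r → r ≤ r' → r' ≤ σ → |φ r' - φ r - ∫ w in r..r', G w| ≤ K * (r' - r)) :
    ∃ l, Tendsto φ (𝓝[>] τ) (𝓝 l) := by
  have hintg : ∀ r ∈ Icc τ σ, IntervalIntegrable G volume τ r := fun r hr =>
    (intervalIntegrable_iff_integrableOn_Icc_of_le hr.1).2 (hG.mono_set (Icc_subset_Icc le_rfl hr.2))
  have hprim : ContinuousOn (fun x => ∫ w in τ..x, G w) (Icc τ σ) := by
    have := intervalIntegral.continuousOn_primitive_interval (μ := volume) (f := G) (a := τ) (b := σ)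
      (by rwa [uIcc_of_le hτσ.le])
    rwa [uIcc_of_le hτσ.le] at this
  let g : ℝ → ℝ := fun r => φ r - ∫ w in τ..r, G w
  have hlip : LipschitzOnWith (Real.toNNReal K) g (Ioc τ σ) := by
    apply LipschitzOnWith.of_dist_le_mul
    have key : ∀ r ∈ Ioc τ σ, ∀ r' ∈ Ioc τ σ, r ≤ r' → |g r' - g r| ≤ K * |r' - r| := by
      intro r hr r' hr' hrr
      have := h r r' hr.1 hrr hr'.2
      rw [abs_of_nonneg (sub_nonneg.2 hrr)]
      convert this using 2
      simp only [g]
      rw [← intervalIntegral.integral_interval_sub_left (hintg r' (Ioc_subset_Icc_self hr'))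
        (hintg r (Ioc_subset_Icc_self hr))]
      ring
    intro x hx y hy
    rw [Real.dist_eq, Real.dist_eq, Real.coe_toNNReal _ hK]
    rcases le_total x y with hxy | hxy
    · rw [abs_sub_comm, abs_sub_comm x y]; exact key x hx y hy hxy
    · exact key y hy x hx hxy
  obtain ⟨g', hg', heq⟩ := hlip.extend_real
  refine ⟨g' τ, ?_⟩
  have t1 : Tendsto g' (𝓝[>] τ) (𝓝 (g' τ)) := (hg'.continuous.tendsto τ).mono_left nhdsWithin_le_nhds
  have t2 : Tendsto (fun x => ∫ w in τ..x, G w) (𝓝[>] τ) (𝓝 0) := by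
    have := (hprim τ ⟨le_rfl, hτσ.le⟩).tendsto
    rw [intervalIntegral.integral_same] at this
    refine this.mono_left ?_
    rw [← nhdsWithin_Ioc_eq_nhdsGT hτσ]
    exact nhdsWithin_mono _ Ioc_subset_Icc_self
  have t3 := t1.add t2
  rw [add_zero] at t3
  refine t3.congr' ?_
  filter_upwards [Ioc_mem_nhdsGT hτσ] with x hx
  rw [← heq hx]; simp [g]

lemma exists_left_lim {φ G : ℝ → ℝ} {τ σ K : ℝ} (hτσ : τ < σ) (hK : 0 ≤ K)
    (hG : IntegrableOn G (Icc τ σ))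
    (h : ∀ r r', τ ≤ r → r ≤ r' → r' < σ → |φ r' - φ r - ∫ w in r..r', G w| ≤ K * (r' - r)) :
    ∃ l, Tendsto φ (𝓝[<] σ) (𝓝 l) := by
  have hintg : ∀ r ∈ Icc τ σ, IntervalIntegrable G volume τ r := fun r hr =>
    (intervalIntegrable_iff_integrableOn_Icc_of_le hr.1).2 (hG.mono_set (Icc_subset_Icc le_rfl hr.2))
  have hprim : ContinuousOn (fun x => ∫ w in τ..x, G w) (Icc τ σ) := by
    have := intervalIntegral.continuousOn_primitive_interval (μ := volume) (f := G) (a := τ) (b := σ)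
      (by rwa [uIcc_of_le hτσ.le])
    rwa [uIcc_of_le hτσ.le] at this
  let g : ℝ → ℝ := fun r => φ r - ∫ w in τ..r, G w
  have hlip : LipschitzOnWith (Real.toNNReal K) g (Ico τ σ) := by
    apply LipschitzOnWith.of_dist_le_mul
    have key : ∀ r ∈ Ico τ σ, ∀ r' ∈ Ico τ σ, r ≤ r' → |g r' - g r| ≤ K * |r' - r| := by
      intro r hr r' hr' hrr
      have := h r r' hr.1 hrr hr'.2
      rw [abs_of_nonneg (sub_nonneg.2 hrr)]
      convert this using 2
      simp only [g]
      rw [← intervalIntegral.integral_interval_sub_left (hintg r' (Ico_subset_Icc_self hr'))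
        (hintg r (Ico_subset_Icc_self hr))]
      ring
    intro x hx y hy
    rw [Real.dist_eq, Real.dist_eq, Real.coe_toNNReal _ hK]
    rcases le_total x y with hxy | hxy
    · rw [abs_sub_comm, abs_sub_comm x y]; exact key x hx y hy hxy
    · exact key y hy x hx hxy
  obtain ⟨g', hg', heq⟩ := hlip.extend_real
  refine ⟨g' σ + ∫ w in τ..σ, G w, ?_⟩
  have t1 : Tendsto g' (𝓝[<] σ) (𝓝 (g' σ)) := (hg'.continuous.tendsto σ).mono_left nhdsWithin_le_nhds
  have t2 : Tendsto (fun x => ∫ w in τ..x, G w) (𝓝[<] σ) (𝓝 (∫ w in τ..σ, G w)) := by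
    have := (hprim σ ⟨hτσ.le, le_rfl⟩).tendsto
    refine this.mono_left ?_
    rw [← nhdsWithin_Ico_eq_nhdsLT hτσ]
    exact nhdsWithin_mono _ Ico_subset_Icc_self
  have t3 := t1.add t2
  refine t3.congr' ?_
  filter_upwards [Ico_mem_nhdsLT hτσ] with x hx
  rw [← heq hx]; simp [g]


lemma transport_open {u ux ut : ℝ → ℝ → ℝ} {v a b : ℝ} (hv : v ≠ 0) (hab : a < b)
    (hx : ∀ x, ∀ t ∈ Icc a b, HasDerivAt (fun y => u y t) (ux x t) x)
    (ht : ∀ x, ∀ t ∈ Icc a b, HasDerivWithinAt (fun s => u x s) (ut x t) (Icc a b) t)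
    (hG : ∀ᵐ y : ℝ, IntegrableOn (fun s => ut (y + v * s) s + v * ux (y + v * s) s) (Icc a b))
    {ε : ℝ} (hε : 0 < ε) :
    GoodSet u (fun y s => ut (y + v * s) s + v * ux (y + v * s) s) v a b
      (2 * ((1 + |v|) * ε)) univ := by
  set G : ℝ → ℝ → ℝ := fun y s => ut (y + v * s) s + v * ux (y + v * s) s with hGdef
  set K := 2 * ((1 + |v|) * ε) with hK
  have hKpos : 0 ≤ K := by positivity
  set S : Set (Set (ℝ × ℝ)) :=
    {V | V ∈ TopologicalSpace.countableBasis (ℝ × ℝ) ∧ GoodSet u G v a b K V} with hS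
  have hScount : S.Countable :=
    (TopologicalSpace.countable_countableBasis (ℝ × ℝ)).mono fun V hV => hV.1
  have hSopen : ∀ V ∈ S, IsOpen V := fun V hV => TopologicalSpace.isOpen_of_mem_countableBasis hV.1
  set Ω := ⋃₀ S with hΩ
  have hΩgood : GoodSet u G v a b K Ω := goodSet_sUnion hScount hSopen (fun V hV => hV.2) hG
  have hΩopen : IsOpen Ω := isOpen_sUnion hSopen
  -- if a neighbourhood is good then the point is in Ω
  have hmem : ∀ z : ℝ × ℝ, ∀ Q : Set (ℝ × ℝ), IsOpen Q → z ∈ Q → GoodSet u G v a b K Q → z ∈ Ω := by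
    intro z Q hQ hz hgood
    obtain ⟨V, hV, hzV, hVQ⟩ :=
      (TopologicalSpace.isBasis_countableBasis (ℝ × ℝ)).exists_subset_of_mem_open hz hQ
    refine ⟨V, ⟨hV, ?_⟩, hzV⟩
    filter_upwards [hgood] with y hy s s' h1 h2 h3 h4
    exact hy s s' h1 h2 h3 fun τ hτ => hVQ (h4 τ hτ)
  have hBstrip : ∀ z ∈ Ωᶜ, z.2 ∈ Icc a b := by
    intro z hz
    by_contra hcon
    apply hz
    refine hmem z (Prod.snd ⁻¹' (Icc a b)ᶜ) (isClosed_Icc.isOpen_compl.preimage continuous_snd) hcon ?_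
    refine Eventually.of_forall fun y s s' h1 h2 h3 h4 => ?_
    exact absurd (h4 s ⟨le_rfl, h2⟩) (by simpa using ⟨h1, h2.trans h3⟩)
  suffices hempty : Ωᶜ = ∅ by
    rw [compl_empty_iff] at hempty
    rwa [hempty] at hΩgood
  by_contra hne
  have hne : (Ωᶜ).Nonempty := nonempty_iff_ne_empty.2 hne
  have hBclosed : IsClosed Ωᶜ := hΩopen.isClosed_compl
  have hcx : ∀ t ∈ Icc a b, Continuous fun x => u x t := fun t h =>
    continuous_iff_continuousAt.2 fun x => (hx x t h).continuousAt
  have hct : ∀ x, ContinuousOn (fun t => u x t) (Icc a b) := fun x t h =>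
    (ht x t h).continuousWithinAt
  -- Baire
  obtain ⟨z0, hz0, r0, hr0, δ, hδ, q1, q2, hcross⟩ : ∃ z0 ∈ Ωᶜ, ∃ r0 > 0, ∃ δ > 0, ∃ q1 q2 : ℝ,
      ∀ z ∈ Ωᶜ, dist z z0 < r0 → z ∈ CrossSet u a b ε δ q1 q2 := by
    have : Nonempty ↥(Ωᶜ) := hne.to_subtype
    have : CompleteSpace ↥(Ωᶜ) := hBclosed.completeSpace_coe
    let fam : ℕ × ℚ × ℚ → Set ↥(Ωᶜ) := fun p =>
      Subtype.val ⁻¹' CrossSet u a b ε (1 / ((p.1 : ℝ) + 1)) p.2.1 p.2.2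
    have hclosed : ∀ p, IsClosed (fam p) := fun p =>
      (crossSet_isClosed (by positivity) hcx hct).preimage continuous_subtype_val
    have hcover : ⋃ p, fam p = univ := by
      rw [eq_univ_iff_forall]
      rintro ⟨z, hz⟩
      have hz2 := hBstrip z hz
      obtain ⟨q1, n1, h1⟩ := cross_aux (hx z.1 z.2 hz2).hasDerivWithinAt (s := univ) hε
      obtain ⟨q2, n2, h2⟩ := cross_aux (ht z.1 z.2 hz2) hε
      refine mem_iUnion.2 ⟨(max n1 n2, q1, q2), hz2, ?_, ?_⟩
      · intro x' hx'
        exact h1 (max n1 n2) (le_max_left _ _) x' (mem_univ _) hx'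
      · intro t' ht' hd
        exact h2 (max n1 n2) (le_max_right _ _) t' ht' hd
    obtain ⟨p, ⟨z, hz⟩⟩ := nonempty_interior_of_iUnion_of_closed hclosed hcover
    obtain ⟨r0, hr0, hball⟩ := Metric.mem_nhds_iff.1 (mem_interior_iff_mem_nhds.1 hz)
    refine ⟨z, z.2, r0, hr0, 1 / ((p.1 : ℝ) + 1), by positivity, p.2.1, p.2.2, fun w hw hd => ?_⟩
    exact hball (show (⟨w, hw⟩ : ↥(Ωᶜ)) ∈ Metric.ball z r0 from hd)
  apply hz0
  set r := min r0 (δ / 4) with hr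
  have hrpos : 0 < r := lt_min hr0 (by linarith)
  set Q := Metric.ball z0 r with hQ
  have hQF : ∀ z ∈ Ωᶜ, z ∈ Q → z ∈ CrossSet u a b ε δ q1 q2 := fun z hz hzQ =>
    hcross z hz (lt_of_lt_of_le hzQ (min_le_left _ _))
  have hQd1 : ∀ z ∈ Q, ∀ z' ∈ Q, |z'.1 - z.1| < δ := by
    intro z hz z' hz'
    have h1 : dist z'.1 z.1 ≤ dist z' z := le_max_left _ _
    have h2 : dist z' z < r + r := lt_of_le_of_lt (dist_triangle_right z' z z0)
      (add_lt_add hz' hz)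
    have : r ≤ δ / 4 := min_le_right _ _
    rw [Real.dist_eq] at h1
    linarith
  have hQd2 : ∀ z ∈ Q, ∀ z' ∈ Q, |z'.2 - z.2| < δ := by
    intro z hz z' hz'
    have h1 : dist z'.2 z.2 ≤ dist z' z := le_max_right _ _
    have h2 : dist z' z < r + r := lt_of_le_of_lt (dist_triangle_right z' z z0)
      (add_lt_add hz' hz)
    have : r ≤ δ / 4 := min_le_right _ _
    rw [Real.dist_eq] at h1
    linarith
  refine hmem z0 Q Metric.isOpen_ball (Metric.mem_ball_self hrpos) ?_
  -- joint estimate on the bad set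
  have hjoint : ∀ z ∈ Ωᶜ ∩ Q, ∀ z' ∈ Ωᶜ ∩ Q,
      |u z'.1 z'.2 - u z.1 z.2 - (q1 * (z'.1 - z.1) + q2 * (z'.2 - z.2))| ≤
        ε * (|z'.1 - z.1| + |z'.2 - z.2|) := by
    intro z hz z' hz'
    have c := hQF z hz.1 hz.2
    have c' := hQF z' hz'.1 hz'.2
    have e1 := c.2.2 z'.2 c'.1 (hQd2 z hz.2 z' hz'.2)
    have e2 := c'.2.1 z.1 (hQd1 z' hz'.2 z hz.2)
    have : u z'.1 z'.2 - u z.1 z.2 - (q1 * (z'.1 - z.1) + q2 * (z'.2 - z.2)) =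
      (u z.1 z'.2 - u z.1 z.2 - q2 * (z'.2 - z.2)) -
      (u z.1 z'.2 - u z'.1 z'.2 - q1 * (z.1 - z'.1)) := by ring
    rw [this]
    refine (abs_sub _ _).trans ?_
    rw [abs_sub_comm z.1 z'.1] at e2
    linarith
  set L := |q1| + |q2| + ε with hL
  have hLpos : 0 ≤ L := by positivity
  set F := Ωᶜ ∩ Q with hF
  set Q' := Q ∩ {z | z.2 ∈ Icc a b} with hQ'
  have H1 : ∀ z ∈ F, ∀ x', (x', z.2) ∈ Q' → |u x' z.2 - u z.1 z.2| ≤ L * |x' - z.1| := by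
    intro z hz x' hx'
    have e := (hQF z hz.1 hz.2).2.1 x' (hQd1 z hz.2 _ hx'.1)
    have : u x' z.2 - u z.1 z.2 = (u x' z.2 - u z.1 z.2 - q1 * (x' - z.1)) + q1 * (x' - z.1) := by ring
    rw [this]
    refine (abs_add_le _ _).trans ?_
    rw [abs_mul, hL]
    nlinarith [mul_nonneg (abs_nonneg q2) (abs_nonneg (x' - z.1))]
  have H2 : ∀ z ∈ F, ∀ t', (z.1, t') ∈ Q' → |u z.1 t' - u z.1 z.2| ≤ L * |t' - z.2| := by
    intro z hz t' ht'
    have e := (hQF z hz.1 hz.2).2.2 t' ht'.2 (hQd2 z hz.2 _ ht'.1)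
    have : u z.1 t' - u z.1 z.2 = (u z.1 t' - u z.1 z.2 - q2 * (t' - z.2)) + q2 * (t' - z.2) := by ring
    rw [this]
    refine (abs_add_le _ _).trans ?_
    rw [abs_mul, hL]
    nlinarith [mul_nonneg (abs_nonneg q1) (abs_nonneg (t' - z.2))]
  have H3 : ∀ z ∈ F, ∀ z' ∈ F, |u z'.1 z'.2 - u z.1 z.2| ≤ L * (|z'.1 - z.1| + |z'.2 - z.2|) := by
    intro z hz z' hz'
    have e := hjoint z hz z' hz'
    have : u z'.1 z'.2 - u z.1 z.2 = (u z'.1 z'.2 - u z.1 z.2 -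
      (q1 * (z'.1 - z.1) + q2 * (z'.2 - z.2))) + (q1 * (z'.1 - z.1) + q2 * (z'.2 - z.2)) := by ring
    rw [this]
    refine (abs_add_le _ _).trans ?_
    have := abs_add_le (q1 * (z'.1 - z.1)) (q2 * (z'.2 - z.2))
    rw [abs_mul, abs_mul] at this
    rw [hL]
    nlinarith [mul_nonneg (abs_nonneg q1) (abs_nonneg (z'.2 - z.2)),
      mul_nonneg (abs_nonneg q2) (abs_nonneg (z'.1 - z.1))]
  let J : ℝ → ℕ → ℕ → Set ℝ := fun θ n m =>
    {y | ∃ α, (y+v*α, α)∈F ∧ ∀ r∈Ioo 0 (1 / ((m : ℝ) + 1)), (y+v*(α+θ*r), α+θ*r)∈Q' ∧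
      1 / ((n : ℝ) + 1) ≤ |u (y+v*(α+θ*r)) (α+θ*r) - u (y+v*α) α|}
  have hJ : ∀ θ, (θ = 1 ∨ θ = -1) → ∀ᵐ y : ℝ, ∀ n m, y ∉ J θ n m := by
    intro θ hθ
    rw [ae_all_iff]; intro n
    rw [ae_all_iff]; intro m
    have : (J θ n m).Countable :=
      countable_jump hv hLpos (by positivity) (by positivity) hθ H1 H2 H3
    exact this.ae_notMem volume
  filter_upwards [hG, hΩgood, hJ 1 (Or.inl rfl), hJ (-1) (Or.inr rfl)] with y hGy hgy hJ1 hJ2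
    s s' has hss hsb hseg
  have hcl : Continuous fun τ : ℝ => (y + v * τ, τ) := by fun_prop
  have hGs : IntegrableOn (G y) (Icc s s') := hGy.mono_set (Icc_subset_Icc has hsb)
  have hst : ∀ τ ∈ Icc s s', τ ∈ Icc a b := fun τ h => Icc_subset_Icc has hsb h
  have hFy : ∀ τ, τ ∉ {τ : ℝ | (y + v * τ, τ) ∈ Ωᶜ} → (y + v * τ, τ) ∈ Ω := by
    intro τ h
    by_contra h'
    exact h h'
  refine line_lemma (φ := fun τ => u (y + v * τ) τ) (G := G y) (c := q2 + v * q1)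
    (ε' := (1 + |v|) * ε) (F := {τ | (y + v * τ, τ) ∈ Ωᶜ}) hss (hBclosed.preimage hcl) hGs
    (by positivity) le_rfl ?_ ?_ ?_ ?_ ?_
  · intro τ hτ hτI
    have c := hQF _ hτ (hseg τ hτI)
    have b1 := cross_bound (hx (y + v * τ) τ (hst τ hτI)).hasDerivWithinAt (s := univ)
      uniqueDiffWithinAt_univ hδ (fun x' _ h => c.2.1 x' h)
    have b2 := cross_bound (ht (y + v * τ) τ (hst τ hτI)) (uniqueDiffOn_Icc hab τ (hst τ hτI)) hδ
      (fun t' h h' => c.2.2 t' h h')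
    have : G y τ - (q2 + v * q1) = (ut (y + v * τ) τ - q2) + v * (ux (y + v * τ) τ - q1) := by
      simp only [hGdef]; ring
    rw [this]
    refine (abs_add_le _ _).trans ?_
    rw [abs_mul]
    nlinarith [mul_le_mul_of_nonneg_left b1 (abs_nonneg v)]
  · intro τ hτ hτI σ hσ hσI
    have e := hjoint (y + v * τ, τ) ⟨hτ, hseg τ hτI⟩ (y + v * σ, σ) ⟨hσ, hseg σ hσI⟩
    simp only at e
    have e1 : y + v * σ - (y + v * τ) = v * (σ - τ) := by ring
    rw [e1, abs_mul] at e
    have : u (y + v * σ) σ - u (y + v * τ) τ - (q2 + v * q1) * (σ - τ) =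
      u (y + v * σ) σ - u (y + v * τ) τ - (q1 * (v * (σ - τ)) + q2 * (σ - τ)) := by ring
    rw [this]
    refine e.trans (le_of_eq (by ring))
  · intro τ σ h1 h2 h3 h4
    exact hgy τ σ (has.trans h1) h2 (h3.trans hsb) fun r hr => hFy r (h4 r hr)
  · intro τ σ h1 h2 h3 hτF h4
    obtain ⟨l, hl⟩ := exists_right_lim (φ := fun τ => u (y + v * τ) τ) (G := G y) h2 hKpos
      (hGs.mono_set (Icc_subset_Icc h1 h3)) (fun r r' hr hrr hr' =>
        hgy r r' (has.trans (h1.trans hr.le)) hrr (hr'.trans (h3.trans hsb))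
          fun w hw => hFy w (h4 w ⟨hr.trans_le hw.1, hw.2.trans hr'⟩))
    by_cases hlφ : l = u (y + v * τ) τ
    · rwa [hlφ] at hl
    exfalso
    have hpos : 0 < |l - u (y + v * τ) τ| := abs_pos.2 (sub_ne_zero.2 hlφ)
    obtain ⟨n, hn⟩ := exists_nat_one_div_lt hpos
    have hev := ((hl.sub_const (u (y + v * τ) τ)).abs).eventually (lt_mem_nhds hn)
    obtain ⟨w, hw, hsub⟩ := (mem_nhdsGT_iff_exists_Ioo_subset).1 hev
    have hw' : 0 < min (w - τ) (σ - τ) := lt_min (sub_pos.2 hw) (sub_pos.2 h2)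
    obtain ⟨m, hm⟩ := exists_nat_one_div_lt hw'
    apply hJ1 n m
    refine ⟨τ, ⟨hτF, hseg τ ⟨h1, h2.le.trans h3⟩⟩, fun r hr => ?_⟩
    have hr1 : r < w - τ := hr.2.trans (hm.trans_le (min_le_left _ _))
    have hr2 : r < σ - τ := hr.2.trans (hm.trans_le (min_le_right _ _))
    have hI : τ + 1 * r ∈ Icc s s' := ⟨by linarith [hr.1], by linarith⟩
    refine ⟨⟨hseg _ hI, hst _ hI⟩, ?_⟩
    have := hsub (show τ + 1 * r ∈ Ioo τ w from ⟨by linarith [hr.1], by linarith⟩)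
    exact le_of_lt this
  · intro τ σ h1 h2 h3 hσF h4
    obtain ⟨l, hl⟩ := exists_left_lim (φ := fun τ => u (y + v * τ) τ) (G := G y) h2 hKpos
      (hGs.mono_set (Icc_subset_Icc h1 h3)) (fun r r' hr hrr hr' =>
        hgy r r' (has.trans (h1.trans hr)) hrr (hr'.le.trans (h3.trans hsb))
          fun w hw => hFy w (h4 w ⟨hr.trans hw.1, hw.2.trans_lt hr'⟩))
    by_cases hlφ : l = u (y + v * σ) σ
    · rwa [hlφ] at hl
    exfalso
    have hpos : 0 < |l - u (y + v * σ) σ| := abs_pos.2 (sub_ne_zero.2 hlφ)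
    obtain ⟨n, hn⟩ := exists_nat_one_div_lt hpos
    have hev := ((hl.sub_const (u (y + v * σ) σ)).abs).eventually (lt_mem_nhds hn)
    obtain ⟨w, hw, hsub⟩ := (mem_nhdsLT_iff_exists_Ioo_subset).1 hev
    have hw' : 0 < min (σ - w) (σ - τ) := lt_min (sub_pos.2 hw) (sub_pos.2 h2)
    obtain ⟨m, hm⟩ := exists_nat_one_div_lt hw'
    apply hJ2 n m
    refine ⟨σ, ⟨hσF, hseg σ ⟨h1.trans h2.le, h3⟩⟩, fun r hr => ?_⟩
    have hr1 : r < σ - w := hr.2.trans (hm.trans_le (min_le_left _ _))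
    have hr2 : r < σ - τ := hr.2.trans (hm.trans_le (min_le_right _ _))
    have hI : σ + -1 * r ∈ Icc s s' := ⟨by linarith [hr.1], by linarith [hr.1]⟩
    refine ⟨⟨hseg _ hI, hst _ hI⟩, ?_⟩
    have := hsub (show σ + -1 * r ∈ Ioo w σ from ⟨by linarith [hr.1], by linarith [hr.1]⟩)
    exact le_of_lt this

lemma transport {u ux ut : ℝ → ℝ → ℝ} {v a b : ℝ} (hv : v ≠ 0) (hab : a < b)
    (hx : ∀ x, ∀ t ∈ Icc a b, HasDerivAt (fun y => u y t) (ux x t) x)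
    (ht : ∀ x, ∀ t ∈ Icc a b, HasDerivWithinAt (fun s => u x s) (ut x t) (Icc a b) t)
    (hG : ∀ᵐ y : ℝ, IntegrableOn (fun s => ut (y + v * s) s + v * ux (y + v * s) s) (Icc a b)) :
    ∀ᵐ y : ℝ, ∀ s ∈ Icc a b, u (y + v * s) s - u (y + v * a) a =
      ∫ w in a..s, (ut (y + v * w) w + v * ux (y + v * w) w) := by
  have h := fun n : ℕ => transport_open hv hab hx ht hG (ε := 1 / ((n : ℝ) + 1)) (by positivity)
  filter_upwards [ae_all_iff.2 h] with y hy s hs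
  rw [← sub_eq_zero, ← abs_eq_zero]
  refine le_antisymm ?_ (abs_nonneg _)
  have lim : Tendsto (fun n : ℕ => 2 * ((1 + |v|) * (1 / ((n : ℝ) + 1))) * (s - a)) atTop (𝓝 0) := by
    have := ((tendsto_one_div_add_atTop_nhds_zero_nat (𝕜 := ℝ)).const_mul (1 + |v|)).const_mul 2
      |>.mul_const (s - a)
    simpa using this
  exact ge_of_tendsto' lim fun n => hy n a s le_rfl hs.1 hs.2 fun _ _ => mem_univ _


lemma shear_integrable {Γ : ℝ → ℝ → ℝ} {v a b : ℝ} (hm : Measurable (Function.uncurry Γ))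
    (hper : ∀ x t, Γ (x + 2 * π) t = Γ x t)
    (hintg : IntegrableOn (Function.uncurry Γ) (Ioc 0 (2 * π) ×ˢ Icc a b)) (c : ℝ) :
    Integrable (fun p : ℝ × ℝ => Γ (p.1 + v * p.2) p.2)
      ((volume.restrict (Ioc c (c + 2 * π))).prod (volume.restrict (Icc a b))) := by
  have h2 : (0:ℝ) ≤ 2 * π := by positivity
  have hper' : ∀ t, Function.Periodic (fun x => Γ x t) (2 * π) := fun t x => hper x t
  rw [IntegrableOn, Measure.volume_eq_prod, ← Measure.prod_restrict] at hintg
  have hmes : Measurable (fun p : ℝ × ℝ => Γ (p.1 + v * p.2) p.2) :=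
    hm.comp (by fun_prop : Measurable fun p : ℝ × ℝ => (p.1 + v * p.2, p.2))
  rw [integrable_prod_iff' hmes.aestronglyMeasurable]
  rw [integrable_prod_iff' hm.aestronglyMeasurable] at hintg
  constructor
  · filter_upwards [hintg.1] with t ht
    have h1 : IntervalIntegrable (fun x => Γ x t) volume 0 (2 * π) :=
      (intervalIntegrable_iff_integrableOn_Ioc_of_le h2).2 ht
    have h3 := ((hper' t).intervalIntegrable₀ (by positivity) h1 (c + v * t) (c + 2 * π + v * t))
    have h4 := h3.comp_add_right (v * t)
    simp only [add_sub_cancel_right] at h4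
    exact (intervalIntegrable_iff_integrableOn_Ioc_of_le (by linarith)).1 h4
  · refine hintg.2.congr (Eventually.of_forall fun t => ?_)
    have hp : Function.Periodic (fun x => ‖Γ x t‖) (2 * π) := fun x => by simp [hper x t]
    have := hp.intervalIntegral_add_eq 0 (c + v * t)
    simp only [Function.uncurry]
    rw [← intervalIntegral.integral_of_le h2, ← intervalIntegral.integral_of_le (by linarith)]
    rw [zero_add] at this
    rw [this, intervalIntegral.integral_comp_add_right (fun x => ‖Γ x t‖)]
    congr 1; ring

lemma transport_int {u ux ut Γ : ℝ → ℝ → ℝ} {v a b : ℝ} (hv : v ≠ 0) (hab : a < b)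
    (hx : ∀ x, ∀ t ∈ Icc a b, HasDerivAt (fun y => u y t) (ux x t) x)
    (ht : ∀ x, ∀ t ∈ Icc a b, HasDerivWithinAt (fun s => u x s) (ut x t) (Icc a b) t)
    (hΓ : ∀ x, ∀ t ∈ Icc a b, ut x t + v * ux x t = Γ x t)
    (hper : ∀ x t, u (x + 2 * π) t = u x t)
    (hΓper : ∀ x t, Γ (x + 2 * π) t = Γ x t)
    (hm : Measurable (Function.uncurry Γ))
    (hintg : IntegrableOn (Function.uncurry Γ) (Ioc 0 (2 * π) ×ˢ Icc a b)) :
    ∀ t ∈ Icc a b, (∫ x in Ioc 0 (2 * π), u x t) - (∫ x in Ioc 0 (2 * π), u x a) =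
      ∫ τ in a..t, ∫ x in Ioc 0 (2 * π), Γ x τ := by
  have h2 : (0:ℝ) ≤ 2 * π := by positivity
  have hsh := shear_integrable (v := v) hm hΓper hintg
  have hG : ∀ᵐ y : ℝ, IntegrableOn (fun s => Γ (y + v * s) s) (Icc a b) := by
    suffices h : ∀ᵐ y ∂(volume.restrict (univ : Set ℝ)),
        IntegrableOn (fun s => Γ (y + v * s) s) (Icc a b) by
      rwa [Measure.restrict_univ] at h
    rw [← iUnion_Ioc_zsmul (show (0:ℝ) < 2 * π by positivity), ae_restrict_iUnion_iff]
    intro n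
    have := (hsh (n • (2 * π))).prod_right_ae
    rw [add_smul, one_smul]
    exact this
  have hG' : ∀ᵐ y : ℝ, IntegrableOn (fun s => ut (y + v * s) s + v * ux (y + v * s) s) (Icc a b) := by
    filter_upwards [hG] with y hy
    refine hy.congr_fun (fun s hs => (hΓ _ s hs).symm) measurableSet_Icc
  have htr := transport hv hab hx ht hG'
  intro t htI
  have hcx : ∀ t ∈ Icc a b, Continuous fun x => u x t := fun t h =>
    continuous_iff_continuousAt.2 fun x => (hx x t h).continuousAt
  have shift : ∀ (w : ℝ → ℝ) (d : ℝ), Function.Periodic w (2 * π) →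
      ∫ x in Ioc 0 (2 * π), w (x + d) = ∫ x in Ioc 0 (2 * π), w x := by
    intro w d hw
    rw [← intervalIntegral.integral_of_le h2, ← intervalIntegral.integral_of_le h2,
      intervalIntegral.integral_comp_add_right]
    have := hw.intervalIntegral_add_eq 0 d
    rw [zero_add] at this
    rw [this, zero_add, add_comm]
  have hci : ∀ s ∈ Icc a b, Integrable (fun y => u (y + v * s) s) (volume.restrict (Ioc 0 (2 * π))) := by
    intro s hs
    have : Continuous fun y => u (y + v * s) s := (hcx s hs).comp (by fun_prop)
    exact (this.integrableOn_Icc (a := 0) (b := 2 * π)).mono_set Ioc_subset_Icc_self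
  have ha : a ∈ Icc a b := ⟨le_rfl, hab.le⟩
  rw [← shift (fun x => u x t) (v * t) (fun x => hper x t),
    ← shift (fun x => u x a) (v * a) (fun x => hper x a), ← integral_sub (hci t htI) (hci a ha)]
  have e1 : ∫ y in Ioc 0 (2 * π), (u (y + v * t) t - u (y + v * a) a) =
      ∫ y in Ioc 0 (2 * π), ∫ τ in Ioc a t, Γ (y + v * τ) τ := by
    apply integral_congr_ae
    filter_upwards [ae_restrict_of_ae htr] with y hy
    rw [hy t htI, intervalIntegral.integral_of_le htI.1]
    refine setIntegral_congr_fun measurableSet_Ioc fun τ hτ => ?_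
    exact hΓ _ τ ⟨hτ.1.le, hτ.2.trans htI.2⟩
  rw [e1, integral_integral_swap, intervalIntegral.integral_of_le htI.1]
  · refine integral_congr_ae (Eventually.of_forall fun τ => ?_)
    exact shift (fun x => Γ x τ) (v * τ) (fun x => hΓper x τ)
  · have := hsh 0
    rw [zero_add] at this
    refine this.mono_measure ?_
    exact Measure.prod_mono le_rfl (Measure.restrict_mono
      (show Ioc a t ⊆ Icc a b from fun x hx => ⟨hx.1.le, hx.2.trans htI.2⟩) le_rfl)


lemma bdd_of_loc_bdd {N : ℝ → ℝ} {K : Set ℝ} (hK : IsCompact K)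
    (h : ∀ x ∈ K, ∃ U ∈ 𝓝[K] x, ∃ m : ℝ, ∀ t ∈ U, N t ≤ m) : ∃ m : ℝ, ∀ t ∈ K, N t ≤ m := by
  refine hK.induction_on (p := fun s => ∃ m : ℝ, ∀ t ∈ s, N t ≤ m) ⟨0, by simp⟩ ?_ ?_ h
  · rintro s t hst ⟨m, hm⟩
    exact ⟨m, fun x hx => hm x (hst hx)⟩
  · rintro s t ⟨m, hm⟩ ⟨m', hm'⟩
    refine ⟨max m m', fun x hx => ?_⟩
    rcases hx with hx | hx
    · exact (hm x hx).trans (le_max_left _ _)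
    · exact (hm' x hx).trans (le_max_right _ _)

lemma time_baire {N : ℝ → ℝ} {T C : ℝ} (hC : 1 ≤ C) (h0 : ∀ t, 0 ≤ N t)
    (hcl : ∀ m : ℕ, IsClosed {t | t ∈ Icc 0 T ∧ N t ≤ m})
    (hloc : ∀ a b, 0 ≤ a → a ≤ b → b ≤ T → (∃ m : ℝ, ∀ t ∈ Icc a b, N t ≤ m) →
      ∀ t ∈ Icc a b, ∀ t' ∈ Icc a b, N t ≤ C * N t') :
    ∃ m : ℝ, ∀ t ∈ Icc 0 T, N t ≤ m := by
  have hloc' : ∀ a ∈ Icc 0 T, ∀ b ∈ Icc 0 T, (∃ m : ℝ, ∀ t ∈ uIcc a b, N t ≤ m) →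
      ∀ t ∈ uIcc a b, ∀ t' ∈ uIcc a b, N t ≤ C * N t' := by
    intro a ha b hb
    exact hloc (a ⊓ b) (a ⊔ b) (le_inf ha.1 hb.1) inf_le_sup (sup_le ha.2 hb.2)
  set B : Set ℝ := {t | t ∈ Icc 0 T ∧ ∀ U ∈ 𝓝[Icc 0 T] t, ∀ m : ℝ, ∃ s ∈ U, m < N s} with hB
  have hnB : ∀ t ∈ Icc 0 T, t ∉ B → ∃ U ∈ 𝓝[Icc 0 T] t, ∃ m : ℝ, ∀ s ∈ U, N s ≤ m := by
    intro t ht htB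
    by_contra hcon
    push Not at hcon
    exact htB ⟨ht, hcon⟩
  by_cases hBe : B = ∅
  · exact bdd_of_loc_bdd isCompact_Icc fun x hx => hnB x hx (by simp [hBe])
  exfalso
  have hBne : B.Nonempty := nonempty_iff_ne_empty.2 hBe
  have hBc : IsClosed B := by
    apply IsSeqClosed.isClosed
    intro w z hw hlim
    have hzI : z ∈ Icc 0 T := isClosed_Icc.mem_of_tendsto hlim (Eventually.of_forall fun j => (hw j).1)
    refine ⟨hzI, fun U hU m => ?_⟩
    obtain ⟨V, hVo, hzV, hVU⟩ := mem_nhdsWithin.1 hU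
    obtain ⟨j, hj⟩ := (hlim.eventually (hVo.mem_nhds hzV)).exists
    exact (hw j).2 U (mem_nhdsWithin.2 ⟨V, hVo, hj, hVU⟩) m
  obtain ⟨t0, ht0, r, hr, m, hm⟩ : ∃ t0 ∈ B, ∃ r > 0, ∃ m : ℕ, ∀ t ∈ B, dist t t0 < r → N t ≤ m := by
    have : Nonempty ↥B := hBne.to_subtype
    have : CompleteSpace ↥B := hBc.completeSpace_coe
    let fam : ℕ → Set ↥B := fun m => Subtype.val ⁻¹' {t | t ∈ Icc 0 T ∧ N t ≤ m}
    have hclosed : ∀ m, IsClosed (fam m) := fun m => (hcl m).preimage continuous_subtype_val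
    have hcover : ⋃ m, fam m = univ := by
      rw [eq_univ_iff_forall]
      rintro ⟨z, hz⟩
      obtain ⟨m, hm⟩ := exists_nat_ge (N z)
      exact mem_iUnion.2 ⟨m, hz.1, hm⟩
    obtain ⟨m, ⟨z, hz⟩⟩ := nonempty_interior_of_iUnion_of_closed hclosed hcover
    obtain ⟨r0, hr0, hball⟩ := Metric.mem_nhds_iff.1 (mem_interior_iff_mem_nhds.1 hz)
    refine ⟨z, z.2, r0, hr0, m, fun w hw hd => ?_⟩
    exact (hball (show (⟨w, hw⟩ : ↥B) ∈ Metric.ball z r0 from hd)).2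
  -- N ≤ C m near t0
  have key : ∀ s ∈ Icc 0 T, dist s t0 < r → N s ≤ C * m := by
    intro s hs hsd
    have hcomp : IsCompact (B ∩ uIcc s t0) := isCompact_uIcc.inter_left hBc
    obtain ⟨b, hb, hbmin⟩ := hcomp.exists_isMinOn ⟨t0, ht0, right_mem_uIcc⟩
      (f := fun b => |b - s|) (by fun_prop)
    have hbd : dist b t0 < r := by
      rw [Real.dist_eq] at hsd ⊢
      have := abs_sub_right_of_mem_uIcc hb.2
      rw [abs_sub_comm s t0] at hsd
      rw [abs_sub_comm b t0]
      linarith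
    have hbN := hm b hb.1 hbd
    have hbI := hb.1.1
    have hsubI : ∀ p ∈ Icc 0 T, ∀ q ∈ Icc 0 T, uIcc p q ⊆ Icc 0 T := fun p hp q hq =>
      uIcc_subset_Icc hp hq
    have hsb : ∀ w ∈ uIcc s b, w ≠ b → N w ≤ C * N s := by
      intro w hw hwb
      have hwI := hsubI s hs b hbI hw
      have hbdd : ∃ m : ℝ, ∀ t ∈ uIcc s w, N t ≤ m := by
        apply bdd_of_loc_bdd isCompact_uIcc
        intro x hx
        have hxI := hsubI s hs w hwI hx
        have hxB : x ∉ B := by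
          intro hxB
          have hx2 : x ∈ uIcc s b := uIcc_subset_uIcc_left hw hx
          have h1 : |b - s| ≤ |x - s| := hbmin ⟨hxB, uIcc_subset_uIcc_left hb.2 hx2⟩
          have h2 : |x - s| ≤ |w - s| := abs_sub_left_of_mem_uIcc hx
          have h3 : |w - s| < |b - s| := by
            rcases le_total s b with h | h
            · rw [uIcc_of_le h] at hw
              rw [abs_of_nonneg (sub_nonneg.2 hw.1), abs_of_nonneg (sub_nonneg.2 h)]
              have := lt_of_le_of_ne hw.2 hwb
              linarith
            · rw [uIcc_of_ge h] at hw
              rw [abs_of_nonpos (sub_nonpos.2 hw.2), abs_of_nonpos (sub_nonpos.2 h)]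
              have := lt_of_le_of_ne hw.1 (Ne.symm hwb)
              linarith
          linarith
        obtain ⟨U, hU, m, hm⟩ := hnB x hxI hxB
        exact ⟨U, nhdsWithin_mono _ (hsubI s hs w hwI) hU, m, hm⟩
      exact hloc' s hs w hwI hbdd w right_mem_uIcc s left_mem_uIcc
    have hbdd : ∃ m : ℝ, ∀ t ∈ uIcc s b, N t ≤ m := by
      refine ⟨max (C * N s) (N b), fun t ht => ?_⟩
      by_cases h : t = b
      · rw [h]; exact le_max_right _ _
      · exact (hsb t ht h).trans (le_max_left _ _)
    have := hloc' s hs b hbI hbdd s left_mem_uIcc b right_mem_uIcc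
    exact this.trans (mul_le_mul_of_nonneg_left hbN (by linarith))
  have hU : Icc 0 T ∩ Metric.ball t0 r ∈ 𝓝[Icc 0 T] t0 :=
    inter_mem self_mem_nhdsWithin (mem_nhdsWithin_of_mem_nhds (Metric.ball_mem_nhds t0 hr))
  obtain ⟨s, hs, hlt⟩ := ht0.2 _ hU (C * m)
  exact absurd (key s hs.1 hs.2) (not_le.2 hlt)


lemma M1_pos (v : ℝ) : 0 < M1 v := by
  unfold M1; positivity

lemma M1_continuous : Continuous M1 := by
  unfold M1; fun_prop

lemma M1_measurable : Measurable M1 := M1_continuous.measurable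

lemma M1_pow_integrable (j : ℕ) : Integrable (fun v => v ^ j * M1 v) := by
  have h := integrable_rpow_mul_exp_neg_mul_sq (b := 1 / 2) (by norm_num) (s := (j : ℝ))
    (by have : (0:ℝ) ≤ j := Nat.cast_nonneg j
        linarith)
  have := h.const_mul (√(2 * π))⁻¹
  refine this.congr (Eventually.of_forall fun v => ?_)
  simp only [M1, Real.rpow_natCast]
  have : -(1 / 2) * v ^ 2 = -v ^ 2 / 2 := by ring
  rw [this]; ring

lemma M1_integrable : Integrable M1 := by
  simpa using M1_pow_integrable 0

lemma M1_integral : ∫ v, M1 v = 1 := by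
  unfold M1
  rw [integral_const_mul]
  have h := integral_gaussian (1 / 2)
  have e : ∀ x : ℝ, -(1 / 2) * x ^ 2 = -x ^ 2 / 2 := fun x => by ring
  simp only [e] at h
  rw [h]
  have : π / (1 / 2) = 2 * π := by ring
  rw [this, inv_mul_cancel₀]
  positivity

lemma M1_hasDerivAt (v : ℝ) : HasDerivAt M1 (-v * M1 v) v := by
  have h : HasDerivAt (fun v : ℝ => -v ^ 2 / 2) (-v) v := by
    have := ((hasDerivAt_id v).pow 2).neg.div_const 2
    convert! this using 1
    simp
    ring
  have := (h.exp).const_mul (√(2 * π))⁻¹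
  convert! this using 1
  simp only [M1]; ring

lemma M1_moment_one : ∫ v, v * M1 v = 0 := by
  have := integral_eq_zero_of_hasDerivAt_of_integrable (f := M1) (f' := fun v => -v * M1 v)
    M1_hasDerivAt (by simpa using (M1_pow_integrable 1).neg) M1_integrable
  simp only [neg_mul, integral_neg] at this
  linarith

lemma M1_moment_rec (j : ℕ) : ∫ v, v ^ (j + 2) * M1 v = (j + 1) * ∫ v, v ^ j * M1 v := by
  have h1 := M1_pow_integrable (j + 2)
  have h2 := M1_pow_integrable j
  have := integral_eq_zero_of_hasDerivAt_of_integrable (f := fun v => v ^ (j + 1) * M1 v)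
    (f' := fun v => (j + 1) * (v ^ j * M1 v) - v ^ (j + 2) * M1 v)
    (fun v => by
      have := (hasDerivAt_pow (j + 1) v).mul (M1_hasDerivAt v)
      convert! this using 1
      rw [Nat.add_sub_cancel]
      push_cast
      ring)
    ((h2.const_mul _).sub h1) (M1_pow_integrable (j + 1))
  rw [integral_sub (h2.const_mul _) h1, integral_const_mul] at this
  linarith

lemma M1_m0 : ∫ v, v ^ 0 * M1 v = 1 := by simpa using M1_integral
lemma M1_m1 : ∫ v, v ^ 1 * M1 v = 0 := by simpa using M1_moment_one
lemma M1_m2 : ∫ v, v ^ 2 * M1 v = 1 := by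
  have := M1_moment_rec 0
  rw [M1_m0] at this; simpa using this
lemma M1_m3 : ∫ v, v ^ 3 * M1 v = 0 := by
  have := M1_moment_rec 1
  rw [M1_m1] at this; simpa using this
lemma M1_m4 : ∫ v, v ^ 4 * M1 v = 3 := by
  have := M1_moment_rec 2
  rw [M1_m2] at this
  rw [this]; norm_num

lemma pow_mul_le (j : ℕ) (v y : ℝ) : |v ^ j * y| ≤ y ^ 2 / M1 v + v ^ (2 * j) * M1 v := by
  have hM := M1_pos v
  have h1 : y ^ 2 / M1 v + v ^ (2 * j) * M1 v = (y ^ 2 + (v ^ j * M1 v) ^ 2) / M1 v := by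
    field_simp; ring
  rw [h1, le_div_iff₀ hM]
  have h2 : |v ^ j * y| * M1 v = |y| * |v ^ j * M1 v| := by
    rw [abs_mul, abs_mul, abs_of_pos hM]; ring
  rw [h2, ← sq_abs y, ← sq_abs (v ^ j * M1 v)]
  nlinarith [sq_nonneg (|y| - |v ^ j * M1 v|), sq_nonneg |y|, sq_nonneg |v ^ j * M1 v|]

lemma pow_mul_integrable {c : ℝ → ℝ} (hc : AEStronglyMeasurable c volume)
    (hi : Integrable (fun v => c v ^ 2 / M1 v)) (j : ℕ) : Integrable (fun v => v ^ j * c v) := by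
  refine (hi.add (M1_pow_integrable (2 * j))).mono' ?_ (Eventually.of_forall fun v => ?_)
  · exact ((continuous_pow j).aestronglyMeasurable).mul hc
  · exact pow_mul_le j v (c v)

lemma bessel {c : ℝ → ℝ} (hc : AEStronglyMeasurable c volume)
    (hi : Integrable (fun v => c v ^ 2 / M1 v)) :
    (∫ v, v ^ 0 * c v) ^ 2 + (∫ v, v ^ 1 * c v) ^ 2 +
      ((∫ v, v ^ 2 * c v) - ∫ v, v ^ 0 * c v) ^ 2 / 2 ≤ ∫ v, c v ^ 2 / M1 v := by
  have i := pow_mul_integrable hc hi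
  set C0 := ∫ v, v ^ 0 * c v with hC0
  set C1 := ∫ v, v ^ 1 * c v with hC1
  set C2 := ∫ v, v ^ 2 * c v with hC2
  set a2 := (C2 - C0) / 2 with ha2
  -- p v = C0 + C1 v + a2 (v^2 - 1)
  have key : ∀ v, c v ^ 2 / M1 v - (2 * (C0 - a2) * (v ^ 0 * c v) + 2 * C1 * (v ^ 1 * c v)
      + 2 * a2 * (v ^ 2 * c v)) + ((C0 - a2) ^ 2 * (v ^ 0 * M1 v) + 2 * (C0 - a2) * C1 * (v ^ 1 * M1 v)
      + (C1 ^ 2 + 2 * (C0 - a2) * a2) * (v ^ 2 * M1 v) + 2 * C1 * a2 * (v ^ 3 * M1 v)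
      + a2 ^ 2 * (v ^ 4 * M1 v)) = (c v - (C0 - a2 + C1 * v + a2 * v ^ 2) * M1 v) ^ 2 / M1 v := by
    intro v
    have hM := (M1_pos v).ne'
    field_simp
    ring
  have hnn : 0 ≤ ∫ v, (c v ^ 2 / M1 v - (2 * (C0 - a2) * (v ^ 0 * c v) + 2 * C1 * (v ^ 1 * c v)
      + 2 * a2 * (v ^ 2 * c v)) + ((C0 - a2) ^ 2 * (v ^ 0 * M1 v) + 2 * (C0 - a2) * C1 * (v ^ 1 * M1 v)
      + (C1 ^ 2 + 2 * (C0 - a2) * a2) * (v ^ 2 * M1 v) + 2 * C1 * a2 * (v ^ 3 * M1 v)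
      + a2 ^ 2 * (v ^ 4 * M1 v))) := by
    apply integral_nonneg
    intro v
    simp only [key]
    exact div_nonneg (sq_nonneg _) (M1_pos v).le
  have m := M1_pow_integrable
  have j1 : Integrable fun v => 2 * (C0 - a2) * (v ^ 0 * c v) + 2 * C1 * (v ^ 1 * c v) :=
    ((i 0).const_mul _).add ((i 1).const_mul _)
  have j2 : Integrable fun v => 2 * (C0 - a2) * (v ^ 0 * c v) + 2 * C1 * (v ^ 1 * c v)
      + 2 * a2 * (v ^ 2 * c v) := j1.add ((i 2).const_mul _)
  have k1 : Integrable fun v => (C0 - a2) ^ 2 * (v ^ 0 * M1 v) + 2 * (C0 - a2) * C1 * (v ^ 1 * M1 v) :=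
    ((m 0).const_mul _).add ((m 1).const_mul _)
  have k2 : Integrable fun v => (C0 - a2) ^ 2 * (v ^ 0 * M1 v) + 2 * (C0 - a2) * C1 * (v ^ 1 * M1 v)
      + (C1 ^ 2 + 2 * (C0 - a2) * a2) * (v ^ 2 * M1 v) := k1.add ((m 2).const_mul _)
  have k3 : Integrable fun v => (C0 - a2) ^ 2 * (v ^ 0 * M1 v) + 2 * (C0 - a2) * C1 * (v ^ 1 * M1 v)
      + (C1 ^ 2 + 2 * (C0 - a2) * a2) * (v ^ 2 * M1 v) + 2 * C1 * a2 * (v ^ 3 * M1 v) :=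
    k2.add ((m 3).const_mul _)
  have k4 : Integrable fun v => (C0 - a2) ^ 2 * (v ^ 0 * M1 v) + 2 * (C0 - a2) * C1 * (v ^ 1 * M1 v)
      + (C1 ^ 2 + 2 * (C0 - a2) * a2) * (v ^ 2 * M1 v) + 2 * C1 * a2 * (v ^ 3 * M1 v)
      + a2 ^ 2 * (v ^ 4 * M1 v) := k3.add ((m 4).const_mul _)
  have j3 : Integrable fun v => c v ^ 2 / M1 v - (2 * (C0 - a2) * (v ^ 0 * c v)
      + 2 * C1 * (v ^ 1 * c v) + 2 * a2 * (v ^ 2 * c v)) := hi.sub j2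
  rw [integral_add j3 k4, integral_sub hi j2, integral_add j1 ((i 2).const_mul _),
    integral_add ((i 0).const_mul _) ((i 1).const_mul _), integral_add k3 ((m 4).const_mul _),
    integral_add k2 ((m 3).const_mul _), integral_add k1 ((m 2).const_mul _),
    integral_add ((m 0).const_mul _) ((m 1).const_mul _)] at hnn
  simp only [integral_const_mul, M1_m0, M1_m1, M1_m2, M1_m3, M1_m4] at hnn
  rw [← hC0, ← hC1, ← hC2] at hnn
  have : C2 = 2 * a2 + C0 := by rw [ha2]; ring
  rw [this] at hnn ⊢
  nlinarith

lemma parseval_real {h : ℝ → ℝ} (hm : AEStronglyMeasurable h (volume.restrict (Ioc 0 (2 * π))))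
    (hi : Integrable (fun x => h x ^ 2) (volume.restrict (Ioc 0 (2 * π)))) :
    HasSum (fun k : ℤ => ((2 * π)⁻¹ * ∫ x in Ioc 0 (2 * π), cos (k * x) * h x) ^ 2 +
      ((2 * π)⁻¹ * ∫ x in Ioc 0 (2 * π), sin (k * x) * h x) ^ 2)
      ((2 * π)⁻¹ * ∫ x in Ioc 0 (2 * π), h x ^ 2) := by
  have hpi : (0:ℝ) < 2 * π := by positivity
  have hL2 : MemLp (fun x => (h x : ℂ)) 2 (volume.restrict (Ioc 0 (2 * π))) :=
    ((memLp_two_iff_integrable_sq hm).2 hi).ofReal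
  have hh : Integrable h (volume.restrict (Ioc 0 (2 * π))) :=
    ((memLp_two_iff_integrable_sq hm).2 hi).integrable (by norm_num)
  have H := hasSum_sq_fourierCoeffOn hpi hL2
  have e : ((2 * π - 0 : ℝ)⁻¹ • ∫ x in (0:ℝ)..(2 * π), ‖(h x : ℂ)‖ ^ 2) =
      (2 * π)⁻¹ * ∫ x in Ioc 0 (2 * π), h x ^ 2 := by
    rw [intervalIntegral.integral_of_le hpi.le]
    simp
  rw [e] at H
  convert! H using 1
  funext k
  have hb : ∀ (ψ : ℝ → ℝ), Continuous ψ → (∀ x, |ψ x| ≤ 1) →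
      Integrable (fun x => ψ x * h x) (volume.restrict (Ioc 0 (2 * π))) := by
    intro ψ hψ hb
    exact hh.bdd_mul (c := 1) hψ.aestronglyMeasurable (Eventually.of_forall hb)
  have hc := hb (fun x => cos (k * x)) (by fun_prop) (fun x => abs_cos_le_one _)
  have hs := hb (fun x => sin (k * x)) (by fun_prop) (fun x => abs_sin_le_one _)
  have e2 : ∀ x : ℝ, fourier (-k) (x : AddCircle (2 * π - 0)) • (h x : ℂ) =
      ((cos (k * x) * h x : ℝ) : ℂ) - ((sin (k * x) * h x : ℝ) : ℂ) * Complex.I := by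
    intro x
    rw [fourier_coe_apply]
    have : (2 * (π:ℂ) * Complex.I * ((-k : ℤ) : ℂ) * (x:ℂ) / ((2 * π - 0 : ℝ) : ℂ)) =
        ((-(k * x) : ℝ) : ℂ) * Complex.I := by
      have : (π : ℂ) ≠ 0 := by exact_mod_cast Real.pi_ne_zero
      push_cast
      field_simp
      ring
    rw [this, Complex.exp_mul_I, ← Complex.ofReal_cos, ← Complex.ofReal_sin, Real.cos_neg, Real.sin_neg]
    simp only [smul_eq_mul]
    push_cast
    ring
  rw [fourierCoeffOn_eq_integral]
  simp only [e2]
  rw [intervalIntegral.integral_of_le hpi.le, integral_sub hc.ofReal (hs.ofReal.mul_const _),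
    integral_mul_const, integral_complex_ofReal, integral_complex_ofReal]
  set a := ∫ x in Ioc 0 (2 * π), cos (k * x) * h x
  set b := ∫ x in Ioc 0 (2 * π), sin (k * x) * h x
  rw [norm_smul]
  have : ‖(a:ℂ) - (b:ℂ) * Complex.I‖ ^ 2 = a ^ 2 + b ^ 2 := by
    rw [← Complex.normSq_eq_norm_sq, Complex.normSq_apply]
    simp; ring
  rw [mul_pow ‖_‖, this]
  simp only [sub_zero, one_div, norm_inv, Real.norm_eq_abs, abs_of_pos hpi]
  ring


noncomputable def bx : Measure ℝ := volume.restrict (Ioc 0 (2 * π))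

instance : IsFiniteMeasure bx := by unfold bx; infer_instance

noncomputable def ck (k : ℤ) (x : ℝ) : ℝ := cos (k * x)
noncomputable def sk (k : ℤ) (x : ℝ) : ℝ := sin (k * x)

noncomputable def Amp (ψ : ℝ → ℝ) (h : ℝ → ℝ → ℝ) (v : ℝ) : ℝ := (2 * π)⁻¹ * ∫ x, ψ x * h x v ∂bx

noncomputable def Mom (j : ℕ) (ψ : ℝ → ℝ) (h : ℝ → ℝ → ℝ) : ℝ := ∫ v, v ^ j * Amp ψ h v

noncomputable def En (k : ℤ) (h : ℝ → ℝ → ℝ) : ℝ :=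
  ∫ v, (Amp (ck k) h v ^ 2 + Amp (sk k) h v ^ 2) / M1 v

noncomputable def Xk (k : ℤ) (h : ℝ → ℝ → ℝ) : ℝ :=
  Mom 0 (ck k) h * Mom 1 (sk k) h - Mom 0 (sk k) h * Mom 1 (ck k) h

noncomputable def ek (k : ℤ) (h : ℝ → ℝ → ℝ) : ℝ := En k h - (2 * 0.47 / k) * Xk k h

structure Nice (h : ℝ → ℝ → ℝ) : Prop where
  meas : Measurable (Function.uncurry h)
  int : Integrable (fun p : ℝ × ℝ => h p.1 p.2 ^ 2 / M1 p.2) (bx.prod volume)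

lemma box_eq : volume.restrict ((Ioc (0:ℝ) (2 * π)) ×ˢ (univ : Set ℝ)) = bx.prod volume := by
  rw [Measure.volume_eq_prod, ← Measure.prod_restrict, Measure.restrict_univ, bx]

lemma HnormSq_eq (h : ℝ → ℝ → ℝ) :
    HnormSq h = (2 * π)⁻¹ * ∫ p, h p.1 p.2 ^ 2 / M1 p.2 ∂(bx.prod volume) := by
  rw [HnormSq, box_eq]

lemma amp_measurable {h : ℝ → ℝ → ℝ} (hm : Measurable (Function.uncurry h)) {ψ : ℝ → ℝ}
    (hψ : Measurable ψ) : Measurable (Amp ψ h) := by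
  have : StronglyMeasurable (fun p : ℝ × ℝ => ψ p.2 * h p.2 p.1) := by
    apply Measurable.stronglyMeasurable
    exact (hψ.comp measurable_snd).mul (hm.comp (measurable_snd.prodMk measurable_fst))
  exact (this.integral_prod_right.measurable).const_mul _

lemma ck_cont (k : ℤ) : Continuous (ck k) := by unfold ck; fun_prop
lemma sk_cont (k : ℤ) : Continuous (sk k) := by unfold sk; fun_prop

lemma nice_section {h : ℝ → ℝ → ℝ} (hn : Nice h) :
    ∀ᵐ v, Integrable (fun x => h x v ^ 2) bx := by
  have := hn.int.prod_left_ae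
  filter_upwards [this] with v hv
  have := hv.mul_const (M1 v)
  refine this.congr (Eventually.of_forall fun x => ?_)
  simp only
  rw [div_mul_cancel₀ _ (M1_pos v).ne']

lemma parseval_ae {h : ℝ → ℝ → ℝ} (hn : Nice h) :
    ∀ᵐ v, HasSum (fun k : ℤ => (Amp (ck k) h v ^ 2 + Amp (sk k) h v ^ 2) / M1 v)
      ((2 * π)⁻¹ * ∫ x, h x v ^ 2 / M1 v ∂bx) := by
  filter_upwards [nice_section hn] with v hv
  have hm : Measurable fun x => h x v := hn.meas.comp (measurable_id.prodMk measurable_const)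
  have := (parseval_real (h := fun x => h x v) hm.aestronglyMeasurable hv).div_const (M1 v)
  rw [integral_div, ← mul_div_assoc]
  exact this

lemma sum_int {h : ℝ → ℝ → ℝ} (hn : Nice h) :
    Integrable (fun v => (2 * π)⁻¹ * ∫ x, h x v ^ 2 / M1 v ∂bx) :=
  (hn.int.integral_prod_right).const_mul _

lemma amp2_meas {h : ℝ → ℝ → ℝ} (hn : Nice h) (k : ℤ) :
    Measurable fun v => (Amp (ck k) h v ^ 2 + Amp (sk k) h v ^ 2) / M1 v :=
  (((amp_measurable hn.meas (ck_cont k).measurable).pow_const 2).add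
    ((amp_measurable hn.meas (sk_cont k).measurable).pow_const 2)).div M1_measurable

lemma amp2_nonneg (h : ℝ → ℝ → ℝ) (k : ℤ) (v : ℝ) :
    0 ≤ (Amp (ck k) h v ^ 2 + Amp (sk k) h v ^ 2) / M1 v :=
  div_nonneg (by positivity) (M1_pos v).le

lemma amp2_int {h : ℝ → ℝ → ℝ} (hn : Nice h) (k : ℤ) :
    Integrable fun v => (Amp (ck k) h v ^ 2 + Amp (sk k) h v ^ 2) / M1 v := by
  refine (sum_int hn).mono' (amp2_meas hn k).aestronglyMeasurable ?_
  filter_upwards [parseval_ae hn] with v hv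
  rw [Real.norm_eq_abs, abs_of_nonneg (amp2_nonneg h k v)]
  exact le_hasSum hv k fun j _ => amp2_nonneg h j v

lemma parseval {h : ℝ → ℝ → ℝ} (hn : Nice h) : HasSum (fun k => En k h) (HnormSq h) := by
  have e : HnormSq h = ∫ v, (2 * π)⁻¹ * ∫ x, h x v ^ 2 / M1 v ∂bx := by
    rw [HnormSq_eq, integral_const_mul, integral_prod_symm _ hn.int]
  rw [e]
  refine hasSum_integral_of_dominated_convergence
    (fun k v => (Amp (ck k) h v ^ 2 + Amp (sk k) h v ^ 2) / M1 v)
    (fun k => (amp2_meas hn k).aestronglyMeasurable)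
    (fun k => Eventually.of_forall fun v => ?_) ?_ ?_ (parseval_ae hn)
  · rw [Real.norm_eq_abs, abs_of_nonneg (amp2_nonneg h k v)]
  · filter_upwards [parseval_ae hn] with v hv using hv.summable
  · refine (sum_int hn).congr ?_
    filter_upwards [parseval_ae hn] with v hv using hv.tsum_eq.symm

lemma ampc_int {h : ℝ → ℝ → ℝ} (hn : Nice h) (k : ℤ) :
    Integrable fun v => Amp (ck k) h v ^ 2 / M1 v := by
  refine (amp2_int hn k).mono' (((amp_measurable hn.meas (ck_cont k).measurable).pow_const 2).div
    M1_measurable).aestronglyMeasurable (Eventually.of_forall fun v => ?_)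
  have hM := M1_pos v
  rw [Real.norm_eq_abs, abs_of_nonneg (by positivity)]
  gcongr
  nlinarith [sq_nonneg (Amp (sk k) h v)]

lemma amps_int {h : ℝ → ℝ → ℝ} (hn : Nice h) (k : ℤ) :
    Integrable fun v => Amp (sk k) h v ^ 2 / M1 v := by
  refine (amp2_int hn k).mono' (((amp_measurable hn.meas (sk_cont k).measurable).pow_const 2).div
    M1_measurable).aestronglyMeasurable (Eventually.of_forall fun v => ?_)
  have hM := M1_pos v
  rw [Real.norm_eq_abs, abs_of_nonneg (by positivity)]
  gcongr
  nlinarith [sq_nonneg (Amp (ck k) h v)]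

lemma bessel_En {h : ℝ → ℝ → ℝ} (hn : Nice h) (k : ℤ) :
    Mom 0 (ck k) h ^ 2 + Mom 1 (ck k) h ^ 2 + (Mom 2 (ck k) h - Mom 0 (ck k) h) ^ 2 / 2 +
    (Mom 0 (sk k) h ^ 2 + Mom 1 (sk k) h ^ 2 + (Mom 2 (sk k) h - Mom 0 (sk k) h) ^ 2 / 2) ≤
      En k h := by
  have h1 := bessel (amp_measurable hn.meas (ck_cont k).measurable).aestronglyMeasurable (ampc_int hn k)
  have h2 := bessel (amp_measurable hn.meas (sk_cont k).measurable).aestronglyMeasurable (amps_int hn k)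
  have e : En k h = (∫ v, Amp (ck k) h v ^ 2 / M1 v) + ∫ v, Amp (sk k) h v ^ 2 / M1 v := by
    rw [← integral_add (ampc_int hn k) (amps_int hn k)]
    simp only [En, add_div]
  rw [e]
  exact add_le_add h1 h2

lemma inv_int_abs_le (k : ℤ) : |((k : ℝ))⁻¹| ≤ 1 := by
  by_cases hk : k = 0
  · simp [hk]
  · rw [abs_inv]
    apply inv_le_one_of_one_le₀
    exact_mod_cast Int.one_le_abs hk

lemma ek_bounds {h : ℝ → ℝ → ℝ} (hn : Nice h) (k : ℤ) :
    (1 - 0.47) * En k h ≤ ek k h ∧ ek k h ≤ (1 + 0.47) * En k h := by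
  have hb := bessel_En hn k
  have hX : |2 * Xk k h| ≤ En k h := by
    unfold Xk
    rw [abs_le]
    constructor <;>
    nlinarith [sq_nonneg (Mom 0 (ck k) h + Mom 1 (sk k) h), sq_nonneg (Mom 0 (sk k) h - Mom 1 (ck k) h),
      sq_nonneg (Mom 0 (ck k) h - Mom 1 (sk k) h), sq_nonneg (Mom 0 (sk k) h + Mom 1 (ck k) h),
      sq_nonneg (Mom 2 (ck k) h - Mom 0 (ck k) h), sq_nonneg (Mom 2 (sk k) h - Mom 0 (sk k) h)]
  have h1 : |(2 * 0.47 / (k:ℝ)) * Xk k h| ≤ 0.47 * En k h := by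
    have : (2 * 0.47 / (k:ℝ)) * Xk k h = 0.47 * ((k:ℝ)⁻¹ * (2 * Xk k h)) := by
      rw [div_eq_mul_inv]; ring
    rw [this, abs_mul, abs_mul, abs_of_pos (by norm_num : (0:ℝ) < 0.47)]
    apply mul_le_mul_of_nonneg_left _ (by norm_num)
    calc _ ≤ 1 * |2 * Xk k h| := mul_le_mul_of_nonneg_right (inv_int_abs_le k) (abs_nonneg _)
      _ ≤ _ := by rw [one_mul]; exact hX
  rw [abs_le] at h1
  unfold ek
  constructor <;> nlinarith [h1.1, h1.2]

lemma En_nonneg (k : ℤ) (h : ℝ → ℝ → ℝ) : 0 ≤ En k h :=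
  integral_nonneg fun v => amp2_nonneg h k v

lemma ek_summable {h : ℝ → ℝ → ℝ} (hn : Nice h) : Summable fun k => ek k h := by
  refine Summable.of_nonneg_of_le (fun k => ?_) (fun k => (ek_bounds hn k).2)
    ((parseval hn).summable.mul_left _)
  exact (mul_nonneg (by norm_num) (En_nonneg k h)).trans (ek_bounds hn k).1

lemma ek_tsum_bounds {h : ℝ → ℝ → ℝ} (hn : Nice h) :
    (1 - 0.47) * HnormSq h ≤ ∑' k, ek k h ∧ ∑' k, ek k h ≤ (1 + 0.47) * HnormSq h := by
  rw [← (parseval hn).tsum_eq, ← tsum_mul_left, ← tsum_mul_left]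
  have s := (parseval hn).summable
  exact ⟨(s.mul_left _).tsum_le_tsum (fun k => (ek_bounds hn k).1) (ek_summable hn),
    (ek_summable hn).tsum_le_tsum (fun k => (ek_bounds hn k).2) (s.mul_left _)⟩

lemma amp_congr {h h' : ℝ → ℝ → ℝ} (he : ∀ᵐ p ∂(bx.prod volume), h p.1 p.2 = h' p.1 p.2) (ψ : ℝ → ℝ) :
    Amp ψ h =ᵐ[volume] Amp ψ h' := by
  have : ∀ᵐ p ∂((volume : Measure ℝ).prod bx), h p.2 p.1 = h' p.2 p.1 := by
    have h1 := (Measure.measurePreserving_swap (μ := (volume : Measure ℝ)) (ν := bx)).quasiMeasurePreserving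
    exact h1.ae he
  have := Measure.ae_ae_of_ae_prod this
  filter_upwards [this] with v hv
  unfold Amp
  congr 1
  apply integral_congr_ae
  filter_upwards [hv] with x hx
  rw [hx]

lemma mom_congr {h h' : ℝ → ℝ → ℝ} (he : ∀ᵐ p ∂(bx.prod volume), h p.1 p.2 = h' p.1 p.2) (ψ : ℝ → ℝ)
    (j : ℕ) : Mom j ψ h = Mom j ψ h' := by
  apply integral_congr_ae
  filter_upwards [amp_congr he ψ] with v hv
  rw [hv]

lemma ek_congr {h h' : ℝ → ℝ → ℝ} (he : ∀ᵐ p ∂(bx.prod volume), h p.1 p.2 = h' p.1 p.2) (k : ℤ) :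
    ek k h = ek k h' := by
  have : En k h = En k h' := by
    apply integral_congr_ae
    filter_upwards [amp_congr he (ck k), amp_congr he (sk k)] with v hv hv'
    rw [hv, hv']
  simp only [ek, Xk, this, mom_congr he]

lemma HnormSq_congr {h h' : ℝ → ℝ → ℝ} (he : ∀ᵐ p ∂(bx.prod volume), h p.1 p.2 = h' p.1 p.2) :
    HnormSq h = HnormSq h' := by
  rw [HnormSq_eq, HnormSq_eq]
  congr 1
  apply integral_congr_ae
  filter_upwards [he] with p hp
  rw [hp]

open Classical in
noncomputable def ent (g : ℝ → ℝ → ℝ) : ℝ :=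
  if AEMeasurable (fun p : ℝ × ℝ => g p.1 p.2 - M1 p.2) (bx.prod volume) then
    ∑' k, ek k (fun x v => g x v - M1 v)
  else HnormSq (fun x v => g x v - M1 v)

lemma HnormSq_nonneg (h : ℝ → ℝ → ℝ) : 0 ≤ HnormSq h := by
  rw [HnormSq_eq]
  refine mul_nonneg (by positivity) (integral_nonneg fun p => ?_)
  exact div_nonneg (sq_nonneg _) (M1_pos _).le

lemma ent_equiv (g : ℝ → ℝ → ℝ)
    (hi : Integrable (fun p : ℝ × ℝ => (g p.1 p.2 - M1 p.2) ^ 2 / M1 p.2) (bx.prod volume)) :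
    (1/2) * ent g ≤ HnormSq (fun x v => g x v - M1 v) ∧
      HnormSq (fun x v => g x v - M1 v) ≤ 4 * ent g := by
  have h0 := HnormSq_nonneg (fun x v => g x v - M1 v)
  unfold ent
  split_ifs with hm
  · let h' : ℝ → ℝ → ℝ := fun x v => hm.mk _ (x, v)
    have he : ∀ᵐ p ∂(bx.prod volume), (fun x v => g x v - M1 v) p.1 p.2 = h' p.1 p.2 := by
      filter_upwards [hm.ae_eq_mk] with p hp
      exact hp
    have hn : Nice h' := ⟨hm.measurable_mk, hi.congr (by
      filter_upwards [he] with p hp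
      rw [← hp])⟩
    have hb := ek_tsum_bounds hn
    rw [← HnormSq_congr (h := fun x v => g x v - M1 v) he] at hb
    have e : ∑' k, ek k (fun x v => g x v - M1 v) = ∑' k, ek k h' :=
      tsum_congr fun k => ek_congr he k
    rw [e]
    constructor <;> linarith [hb.1, hb.2]
  · constructor <;> linarith


lemma prim_cont {y h : ℝ → ℝ} {a b : ℝ} (hab : a ≤ b) (hi : IntegrableOn h (Icc a b))
    (he : ∀ t ∈ Icc a b, y t - y a = ∫ τ in a..t, h τ) : ContinuousOn y (Icc a b) := by
  have hprim : ContinuousOn (fun x => ∫ w in a..x, h w) (Icc a b) := by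
    have := intervalIntegral.continuousOn_primitive_interval (μ := volume) (f := h) (a := a) (b := b)
      (by rwa [uIcc_of_le hab])
    rwa [uIcc_of_le hab] at this
  refine (hprim.add (continuousOn_const (c := y a))).congr fun t ht => ?_
  have := he t ht
  simp only [Pi.add_apply]
  linarith

lemma prim_deriv {y h : ℝ → ℝ} {a b : ℝ} (hab : a ≤ b) (hc : ContinuousOn h (Icc a b))
    (he : ∀ t ∈ Icc a b, y t - y a = ∫ τ in a..t, h τ) :
    ∀ t ∈ Icc a b, HasDerivWithinAt y (h t) (Icc a b) t := by
  intro t ht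
  have hH : Continuous (IccExtend hab (domRestrict (Icc a b) h)) :=
    (continuousOn_iff_continuous_domRestrict.1 hc).Icc_extend'
  have heq : ∀ τ ∈ Icc a b, IccExtend hab (domRestrict (Icc a b) h) τ = h τ := fun τ hτ => by
    rw [IccExtend_of_mem _ _ hτ]; rfl
  have h1 : HasDerivAt (fun t => y a + ∫ τ in a..t, IccExtend hab (domRestrict (Icc a b) h) τ)
      (IccExtend hab (domRestrict (Icc a b) h) t) t :=
    ((hH.integral_hasStrictDerivAt a t).hasDerivAt).const_add _
  rw [heq t ht] at h1
  have e : ∀ t ∈ Icc a b, y t = y a + ∫ τ in a..t, IccExtend hab (domRestrict (Icc a b) h) τ := by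
    intro t ht
    have e2 : ∫ τ in a..t, IccExtend hab (domRestrict (Icc a b) h) τ = ∫ τ in a..t, h τ := by
      apply intervalIntegral.integral_congr
      intro τ hτ
      rw [uIcc_of_le ht.1] at hτ
      exact heq τ ⟨hτ.1, hτ.2.trans ht.2⟩
    rw [e2, ← he t ht]; ring
  exact h1.hasDerivWithinAt.congr e (e t ht)

lemma int_vt {α : Type*} [MeasurableSpace α] {μ : Measure α} [SFinite μ] {F : α → ℝ → ℝ} {a b K : ℝ}
    (hm : Measurable (Function.uncurry F)) (hi : ∀ t ∈ Icc a b, Integrable (fun v => F v t) μ)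
    (hK : ∀ t ∈ Icc a b, ∫ v, |F v t| ∂μ ≤ K) :
    Integrable (fun p : α × ℝ => F p.1 p.2) (μ.prod (volume.restrict (Icc a b))) := by
  have hm' : Measurable (fun p : α × ℝ => F p.1 p.2) := hm
  rw [integrable_prod_iff' hm'.aestronglyMeasurable]
  constructor
  · exact (ae_restrict_iff' measurableSet_Icc).2 (Eventually.of_forall fun t ht => hi t ht)
  · refine Integrable.mono' (g := fun _ => K) (integrable_const _) ?_ ?_
    · have : StronglyMeasurable (fun p : ℝ × α => ‖F p.2 p.1‖) :=
        ((hm.comp measurable_swap).norm).stronglyMeasurable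
      exact this.integral_prod_right.aestronglyMeasurable
    · refine (ae_restrict_iff' measurableSet_Icc).2 (Eventually.of_forall fun t ht => ?_)
      have h0 : 0 ≤ ∫ v, ‖F v t‖ ∂μ := integral_nonneg fun v => norm_nonneg _
      rw [Real.norm_eq_abs, abs_of_nonneg h0]
      exact hK t ht

structure ModeHyp (κ a b m : ℝ) (c s : ℝ → ℝ → ℝ) : Prop where
  mc : Measurable (Function.uncurry c)
  ms : Measurable (Function.uncurry s)
  ic : ∀ t ∈ Icc a b, Integrable (fun v => c v t ^ 2 / M1 v)
  is : ∀ t ∈ Icc a b, Integrable (fun v => s v t ^ 2 / M1 v)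
  bc : ∀ t ∈ Icc a b, ∫ v, c v t ^ 2 / M1 v ≤ m
  bs : ∀ t ∈ Icc a b, ∫ v, s v t ^ 2 / M1 v ≤ m
  eqc : ∀ᵐ v, ∀ t ∈ Icc a b, c v t - c v a =
    ∫ τ in a..t, (M1 v * (∫ w, w ^ 0 * c w τ) - c v τ - κ * (v * s v τ))
  eqs : ∀ᵐ v, ∀ t ∈ Icc a b, s v t - s v a =
    ∫ τ in a..t, (M1 v * (∫ w, w ^ 0 * s w τ) - s v τ + κ * (v * c v τ))

namespace ModeHyp

variable {κ a b m : ℝ} {c s : ℝ → ℝ → ℝ}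

lemma symm (H : ModeHyp κ a b m c s) : ModeHyp (-κ) a b m s c where
  mc := H.ms
  ms := H.mc
  ic := H.is
  is := H.ic
  bc := H.bs
  bs := H.bc
  eqc := by
    filter_upwards [H.eqs] with v hv t ht
    rw [hv t ht]; congr 1; ext τ; ring
  eqs := by
    filter_upwards [H.eqc] with v hv t ht
    rw [hv t ht]; congr 1; ext τ; ring

lemma secm (H : ModeHyp κ a b m c s) (t : ℝ) : Measurable fun v => c v t :=
  H.mc.comp (measurable_id.prodMk measurable_const)

lemma ipow (H : ModeHyp κ a b m c s) (j : ℕ) (t : ℝ) (ht : t ∈ Icc a b) :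
    Integrable fun v => v ^ j * c v t :=
  pow_mul_integrable (H.secm t).aestronglyMeasurable (H.ic t ht) j

lemma bpow (H : ModeHyp κ a b m c s) (j : ℕ) (t : ℝ) (ht : t ∈ Icc a b) :
    ∫ v, |v ^ j * c v t| ≤ m + ∫ v, v ^ (2 * j) * M1 v := by
  calc ∫ v, |v ^ j * c v t| ≤ ∫ v, (c v t ^ 2 / M1 v + v ^ (2 * j) * M1 v) :=
        integral_mono (H.ipow j t ht).abs ((H.ic t ht).add (M1_pow_integrable _))
          fun v => pow_mul_le j v _
    _ = _ := integral_add (H.ic t ht) (M1_pow_integrable _)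
    _ ≤ _ := by gcongr; exact H.bc t ht

lemma iprod (H : ModeHyp κ a b m c s) (j : ℕ) :
    Integrable (fun p : ℝ × ℝ => p.1 ^ j * c p.1 p.2) (volume.prod (volume.restrict (Icc a b))) :=
  int_vt (F := fun v t => v ^ j * c v t) ((measurable_fst.pow_const j).mul H.mc)
    (fun t ht => H.ipow j t ht) (fun t ht => H.bpow j t ht)

lemma imom (H : ModeHyp κ a b m c s) (j : ℕ) :
    IntegrableOn (fun t => ∫ v, v ^ j * c v t) (Icc a b) :=
  (H.iprod j).integral_prod_right

lemma mom_eq (H : ModeHyp κ a b m c s) (j : ℕ) : ∀ t ∈ Icc a b,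
    (∫ v, v ^ j * c v t) - (∫ v, v ^ j * c v a) = ∫ τ in a..t,
      ((∫ v, v ^ j * M1 v) * (∫ v, v ^ 0 * c v τ) - (∫ v, v ^ j * c v τ) -
        κ * ∫ v, v ^ (j + 1) * s v τ) := by
  intro t ht
  have ha : a ∈ Icc a b := ⟨le_rfl, ht.1.trans ht.2⟩
  have hsub : Ioc a t ⊆ Icc a b := fun x hx => ⟨hx.1.le, hx.2.trans ht.2⟩
  rw [← integral_sub (H.ipow j t ht) (H.ipow j a ha)]
  have e1 : ∫ v, (v ^ j * c v t - v ^ j * c v a) = ∫ v, ∫ τ in Ioc a t,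
      ((v ^ j * M1 v) * (∫ w, w ^ 0 * c w τ) - v ^ j * c v τ - κ * (v ^ (j + 1) * s v τ)) := by
    apply integral_congr_ae
    filter_upwards [H.eqc] with v hv
    rw [← mul_sub, hv t ht, intervalIntegral.integral_of_le ht.1, ← integral_const_mul]
    congr 1; ext τ; ring
  have hle : (volume : Measure ℝ).prod (volume.restrict (Ioc a t)) ≤
      (volume : Measure ℝ).prod (volume.restrict (Icc a b)) :=
    Measure.prod_mono le_rfl (Measure.restrict_mono hsub le_rfl)
  rw [e1, integral_integral_swap, intervalIntegral.integral_of_le ht.1]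
  · refine setIntegral_congr_fun measurableSet_Ioc fun τ hτ => ?_
    have hτ' := hsub hτ
    have i1 : Integrable fun v => (v ^ j * M1 v) * (∫ w, w ^ 0 * c w τ) :=
      (M1_pow_integrable j).mul_const _
    have i2 := H.ipow j τ hτ'
    have i3 : Integrable fun v => κ * (v ^ (j + 1) * s v τ) := (H.symm.ipow (j + 1) τ hτ').const_mul κ
    have i12 : Integrable fun v => (v ^ j * M1 v) * (∫ w, w ^ 0 * c w τ) - v ^ j * c v τ := i1.sub i2
    rw [integral_sub i12 i3, integral_sub i1 i2, integral_mul_const, integral_const_mul]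
  · refine Integrable.mono_measure ?_ hle
    exact (((M1_pow_integrable j).mul_prod (H.imom 0)).sub (H.iprod j)).sub
      ((H.symm.iprod (j + 1)).const_mul κ)

lemma mom_cont (H : ModeHyp κ a b m c s) (hab : a ≤ b) (j : ℕ) :
    ContinuousOn (fun t => ∫ v, v ^ j * c v t) (Icc a b) :=
  prim_cont hab ((((H.imom 0).const_mul _).sub (H.imom j)).sub ((H.symm.imom (j + 1)).const_mul κ))
    (H.mom_eq j)

lemma mom_deriv (H : ModeHyp κ a b m c s) (hab : a ≤ b) (j : ℕ) : ∀ t ∈ Icc a b,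
    HasDerivWithinAt (fun t => ∫ v, v ^ j * c v t)
      ((∫ v, v ^ j * M1 v) * (∫ v, v ^ 0 * c v t) - (∫ v, v ^ j * c v t) -
        κ * ∫ v, v ^ (j + 1) * s v t) (Icc a b) t :=
  prim_deriv hab (((continuousOn_const.mul (H.mom_cont hab 0)).sub (H.mom_cont hab j)).sub
    (continuousOn_const.mul (H.symm.mom_cont hab (j + 1)))) (H.mom_eq j)

lemma sec_int (H : ModeHyp κ a b m c s) : ∀ᵐ v, IntegrableOn (fun t => c v t) (Icc a b) := by
  have := (H.iprod 0).prod_right_ae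
  filter_upwards [this] with v hv
  simp only [pow_zero, one_mul] at hv; exact hv

lemma sec_cont (H : ModeHyp κ a b m c s) (hab : a ≤ b) :
    ∀ᵐ v, ContinuousOn (fun t => c v t) (Icc a b) := by
  filter_upwards [H.eqc, H.sec_int, H.symm.sec_int] with v hv h1 h2
  exact prim_cont hab ((((H.imom 0).const_mul _).sub h1).sub ((h2.const_mul v).const_mul κ)) hv

lemma sec_deriv (H : ModeHyp κ a b m c s) (hab : a ≤ b) :
    ∀ᵐ v, ∀ t ∈ Icc a b, HasDerivWithinAt (fun t => c v t)
      (M1 v * (∫ w, w ^ 0 * c w t) - c v t - κ * (v * s v t)) (Icc a b) t := by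
  filter_upwards [H.eqc, H.sec_cont hab, H.symm.sec_cont hab] with v hv h1 h2
  exact prim_deriv hab (((continuousOn_const.mul (H.mom_cont hab 0)).sub h1).sub
    (continuousOn_const.mul (continuousOn_const.mul h2))) hv

lemma sq_prod (H : ModeHyp κ a b m c s) :
    Integrable (fun p : ℝ × ℝ => c p.1 p.2 ^ 2 / M1 p.1) (volume.prod (volume.restrict (Icc a b))) := by
  refine int_vt (F := fun v t => c v t ^ 2 / M1 v) (K := m)
    ((H.mc.pow_const 2).div (M1_measurable.comp measurable_fst))
    (fun t ht => H.ic t ht) (fun t ht => ?_)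
  refine le_trans (le_of_eq ?_) (H.bc t ht)
  congr 1; ext v
  exact abs_of_nonneg (div_nonneg (sq_nonneg _) (M1_pos v).le)

lemma mc_prod (H : ModeHyp κ a b m c s) :
    Integrable (fun p : ℝ × ℝ => (∫ w, w ^ 0 * c w p.2) * c p.1 p.2)
      (volume.prod (volume.restrict (Icc a b))) := by
  set K := m + ∫ v, v ^ (2 * 0) * M1 v with hK
  have habs : ∀ t ∈ Icc a b, |∫ w, w ^ 0 * c w t| ≤ K := fun t ht =>
    (abs_integral_le_integral_abs).trans (H.bpow 0 t ht)
  refine int_vt (F := fun v t => (∫ w, w ^ 0 * c w t) * c v t) (K := K * K) ?_ ?_ ?_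
  · refine Measurable.mul ?_ H.mc
    have : StronglyMeasurable (fun p : ℝ × ℝ => p.2 ^ 0 * c p.2 p.1) :=
      ((measurable_snd.pow_const 0).mul (H.mc.comp measurable_swap)).stronglyMeasurable
    have h2 : StronglyMeasurable (fun t : ℝ => ∫ w, w ^ 0 * c w t) := this.integral_prod_right'
    exact (h2.measurable).comp measurable_snd
  · intro t ht
    have := H.ipow 0 t ht
    simp only [pow_zero, one_mul] at this ⊢
    exact this.const_mul _
  · intro t ht
    have h1 := H.bpow 0 t ht
    have h2 := habs t ht
    simp only [abs_mul]
    rw [integral_const_mul]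
    have e : ∀ v, |c v t| = |v ^ 0 * c v t| := fun v => by simp
    simp only [e]
    refine mul_le_mul h2 h1 (integral_nonneg fun v => abs_nonneg _) ((abs_nonneg _).trans h2)

lemma energy_sec (H : ModeHyp κ a b m c s) (hab : a ≤ b) :
    ∀ᵐ v, ∀ t ∈ Icc a b, (c v t ^ 2 + s v t ^ 2) / M1 v - (c v a ^ 2 + s v a ^ 2) / M1 v =
      ∫ τ in a..t, (2 * ((∫ w, w ^ 0 * c w τ) * c v τ) + 2 * ((∫ w, w ^ 0 * s w τ) * s v τ)
        - 2 * (c v τ ^ 2 / M1 v) - 2 * (s v τ ^ 2 / M1 v)) := by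
  filter_upwards [H.sec_deriv hab, H.symm.sec_deriv hab, H.sec_cont hab, H.symm.sec_cont hab]
    with v h1 h2 c1 c2 t ht
  have hM := (M1_pos v).ne'
  have hd : ∀ τ ∈ Icc a b, HasDerivWithinAt (fun τ => (c v τ ^ 2 + s v τ ^ 2) / M1 v)
      (2 * ((∫ w, w ^ 0 * c w τ) * c v τ) + 2 * ((∫ w, w ^ 0 * s w τ) * s v τ)
        - 2 * (c v τ ^ 2 / M1 v) - 2 * (s v τ ^ 2 / M1 v)) (Icc a b) τ := by
    intro τ hτ
    have := (((h1 τ hτ).pow 2).add ((h2 τ hτ).pow 2)).div_const (M1 v)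
    convert! this using 1
    simp only [Nat.cast_ofNat]
    field_simp
    ring
  have hcont : ContinuousOn (fun τ => 2 * ((∫ w, w ^ 0 * c w τ) * c v τ) +
      2 * ((∫ w, w ^ 0 * s w τ) * s v τ) - 2 * (c v τ ^ 2 / M1 v) - 2 * (s v τ ^ 2 / M1 v)) (Icc a b) :=
    (((continuousOn_const.mul ((H.mom_cont hab 0).mul c1)).add
      (continuousOn_const.mul ((H.symm.mom_cont hab 0).mul c2))).sub
      (continuousOn_const.mul ((c1.pow 2).div_const _))).sub
      (continuousOn_const.mul ((c2.pow 2).div_const _))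
  symm
  apply intervalIntegral.integral_eq_sub_of_hasDerivAt_of_le ht.1
  · exact fun τ hτ => ((hd τ ⟨hτ.1, hτ.2.trans ht.2⟩).continuousWithinAt).mono
      (Icc_subset_Icc le_rfl ht.2)
  · intro τ hτ
    exact (hd τ ⟨hτ.1.le, hτ.2.le.trans ht.2⟩).hasDerivAt
      (Icc_mem_nhds hτ.1 (hτ.2.trans_le ht.2))
  · apply ContinuousOn.intervalIntegrable
    rw [uIcc_of_le ht.1]
    exact hcont.mono (Icc_subset_Icc le_rfl ht.2)

lemma isq (H : ModeHyp κ a b m c s) (t : ℝ) (ht : t ∈ Icc a b) :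
    Integrable (fun v => (c v t ^ 2 + s v t ^ 2) / M1 v) := by
  simp only [add_div]
  exact (H.ic t ht).add (H.is t ht)

lemma energy_eq (H : ModeHyp κ a b m c s) (hab : a ≤ b) : ∀ t ∈ Icc a b,
    (∫ v, (c v t ^ 2 + s v t ^ 2) / M1 v) - (∫ v, (c v a ^ 2 + s v a ^ 2) / M1 v) =
      ∫ τ in a..t, (2 * (∫ w, w ^ 0 * c w τ) ^ 2 + 2 * (∫ w, w ^ 0 * s w τ) ^ 2
        - 2 * ∫ v, (c v τ ^ 2 + s v τ ^ 2) / M1 v) := by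
  intro t ht
  have ha : a ∈ Icc a b := ⟨le_rfl, ht.1.trans ht.2⟩
  have hsub : Ioc a t ⊆ Icc a b := fun x hx => ⟨hx.1.le, hx.2.trans ht.2⟩
  have hle : (volume : Measure ℝ).prod (volume.restrict (Ioc a t)) ≤
      (volume : Measure ℝ).prod (volume.restrict (Icc a b)) :=
    Measure.prod_mono le_rfl (Measure.restrict_mono hsub le_rfl)
  rw [← integral_sub (H.isq t ht) (H.isq a ha)]
  have e1 : ∫ v, ((c v t ^ 2 + s v t ^ 2) / M1 v - (c v a ^ 2 + s v a ^ 2) / M1 v) =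
      ∫ v, ∫ τ in Ioc a t, (2 * ((∫ w, w ^ 0 * c w τ) * c v τ) + 2 * ((∫ w, w ^ 0 * s w τ) * s v τ)
        - 2 * (c v τ ^ 2 / M1 v) - 2 * (s v τ ^ 2 / M1 v)) := by
    apply integral_congr_ae
    filter_upwards [H.energy_sec hab] with v hv
    rw [hv t ht, intervalIntegral.integral_of_le ht.1]
  rw [e1, integral_integral_swap, intervalIntegral.integral_of_le ht.1]
  · refine setIntegral_congr_fun measurableSet_Ioc fun τ hτ => ?_
    have hτ' := hsub hτ
    have i1 : Integrable fun v => 2 * ((∫ w, w ^ 0 * c w τ) * c v τ) := by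
      have := H.ipow 0 τ hτ'
      simp only [pow_zero, one_mul] at this ⊢
      exact (this.const_mul _).const_mul _
    have i2 : Integrable fun v => 2 * ((∫ w, w ^ 0 * s w τ) * s v τ) := by
      have := H.symm.ipow 0 τ hτ'
      simp only [pow_zero, one_mul] at this ⊢
      exact (this.const_mul _).const_mul _
    have i3 := (H.ic τ hτ').const_mul 2
    have i4 := (H.is τ hτ').const_mul 2
    have i12 : Integrable fun v => 2 * ((∫ w, w ^ 0 * c w τ) * c v τ) +
      2 * ((∫ w, w ^ 0 * s w τ) * s v τ) := i1.add i2
    have i123 : Integrable fun v => 2 * ((∫ w, w ^ 0 * c w τ) * c v τ) +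
      2 * ((∫ w, w ^ 0 * s w τ) * s v τ) - 2 * (c v τ ^ 2 / M1 v) := i12.sub i3
    rw [integral_sub i123 i4, integral_sub i12 i3, integral_add i1 i2]
    simp only [integral_const_mul, add_div]
    rw [integral_add (H.ic τ hτ') (H.is τ hτ')]
    simp only [pow_zero, one_mul]
    ring
  · refine Integrable.mono_measure ?_ hle
    exact (((H.mc_prod.const_mul 2).add (H.symm.mc_prod.const_mul 2)).sub (H.sq_prod.const_mul 2)).sub
      (H.symm.sq_prod.const_mul 2)

lemma energy_deriv (H : ModeHyp κ a b m c s) (hab : a ≤ b) : ∀ t ∈ Icc a b,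
    HasDerivWithinAt (fun t => ∫ v, (c v t ^ 2 + s v t ^ 2) / M1 v)
      (2 * (∫ w, w ^ 0 * c w t) ^ 2 + 2 * (∫ w, w ^ 0 * s w t) ^ 2
        - 2 * ∫ v, (c v t ^ 2 + s v t ^ 2) / M1 v) (Icc a b) t := by
  have c1 := H.mom_cont hab 0
  have c2 := H.symm.mom_cont hab 0
  have hE : IntegrableOn (fun t => ∫ v, (c v t ^ 2 + s v t ^ 2) / M1 v) (Icc a b) := by
    have := (H.sq_prod.add H.symm.sq_prod).integral_prod_right
    simp only [Pi.add_apply, ← add_div] at this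
    exact this
  have hcE : ContinuousOn (fun t => ∫ v, (c v t ^ 2 + s v t ^ 2) / M1 v) (Icc a b) := by
    refine prim_cont hab ?_ (H.energy_eq hab)
    have k1 : IntegrableOn (fun τ => 2 * (∫ w, w ^ 0 * c w τ) ^ 2) (Icc a b) :=
      (continuousOn_const.mul (c1.pow 2)).integrableOn_Icc
    have k2 : IntegrableOn (fun τ => 2 * (∫ w, w ^ 0 * s w τ) ^ 2) (Icc a b) :=
      (continuousOn_const.mul (c2.pow 2)).integrableOn_Icc
    exact (k1.add k2).sub (hE.const_mul 2)
  exact prim_deriv hab (((continuousOn_const.mul (c1.pow 2)).add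
    (continuousOn_const.mul (c2.pow 2))).sub (continuousOn_const.mul hcE)) (H.energy_eq hab)

end ModeHyp


lemma nice_pow {h : ℝ → ℝ → ℝ} (hn : Nice h) (j : ℕ) :
    Integrable (fun p : ℝ × ℝ => p.2 ^ j * h p.1 p.2) (bx.prod volume) := by
  have h1 : Integrable (fun p : ℝ × ℝ => (1:ℝ) * (p.2 ^ (2 * j) * M1 p.2)) (bx.prod volume) :=
    (integrable_const (1:ℝ)).mul_prod (M1_pow_integrable (2 * j))
  refine (hn.int.add h1).mono' ?_ (Eventually.of_forall fun p => ?_)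
  · exact ((measurable_snd.pow_const j).mul hn.meas).aestronglyMeasurable
  · simpa using pow_mul_le j p.2 (h p.1 p.2)

lemma mom0_eq {h : ℝ → ℝ → ℝ} (hn : Nice h) {ψ : ℝ → ℝ} (hψ : Continuous ψ) {K : ℝ}
    (hK : ∀ x, |ψ x| ≤ K) :
    ∫ w, w ^ 0 * Amp ψ h w = (2 * π)⁻¹ * ∫ x, ψ x * (∫ w, h x w) ∂bx := by
  have hi : Integrable (fun p : ℝ × ℝ => ψ p.1 * h p.1 p.2) (bx.prod volume) := by
    have := nice_pow hn 0
    simp only [pow_zero, one_mul] at this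
    exact this.bdd_mul (c := K) (hψ.measurable.comp measurable_fst).aestronglyMeasurable
      (Eventually.of_forall fun p => hK p.1)
  simp only [pow_zero, one_mul, Amp]
  rw [integral_const_mul, ← integral_integral_swap hi]
  simp only [integral_const_mul]

structure Sol (g gx : ℝ → ℝ → ℝ → ℝ) : Prop where
  meas : Measurable (fun p : ℝ × ℝ × ℝ => g p.1 p.2.1 p.2.2)
  per : ∀ x v t, g (x + 2 * π) v t = g x v t
  derx : ∀ᵐ v, ∀ x t, 0 ≤ t → HasDerivAt (fun y => g y v t) (gx x v t) x
  dert : ∀ᵐ v, ∀ x t, 0 ≤ t → HasDerivWithinAt (fun s => g x v s)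
    (M1 v * (∫ w, g x w t) - g x v t - v * gx x v t) (Ici 0) t
  int : ∀ t, 0 ≤ t → Integrable (fun p : ℝ × ℝ => g p.1 p.2 t ^ 2 / M1 p.2) (bx.prod volume)

namespace Sol
variable {g gx : ℝ → ℝ → ℝ → ℝ} {a b m : ℝ}

lemma nice (S : Sol g gx) {t : ℝ} (ht : 0 ≤ t) : Nice fun x v => g x v t where
  meas := S.meas.comp (measurable_fst.prodMk (measurable_snd.prodMk measurable_const))
  int := S.int t ht

lemma sq_int (S : Sol g gx) (ha : 0 ≤ a)
    (hm : ∀ t ∈ Icc a b, HnormSq (fun x v => g x v t) ≤ m) :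
    Integrable (fun p : ℝ × ℝ × ℝ => g p.2.1 p.1 p.2.2 ^ 2 / M1 p.1)
      ((volume : Measure ℝ).prod (bx.prod (volume.restrict (Icc a b)))) := by
  have h1 : Integrable (fun p : (ℝ × ℝ) × ℝ => g p.1.1 p.1.2 p.2 ^ 2 / M1 p.1.2)
      ((bx.prod volume).prod (volume.restrict (Icc a b))) := by
    refine int_vt (F := fun (q : ℝ × ℝ) t => g q.1 q.2 t ^ 2 / M1 q.2) (K := 2 * π * m) ?_
      (fun t ht => S.int t (ha.trans ht.1)) ?_
    · have hg : Measurable fun p : (ℝ × ℝ) × ℝ => g p.1.1 p.1.2 p.2 :=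
        S.meas.comp (by fun_prop : Measurable fun p : (ℝ × ℝ) × ℝ => (p.1.1, p.1.2, p.2))
      exact (hg.pow_const 2).div
        (M1_measurable.comp (by fun_prop : Measurable fun p : (ℝ × ℝ) × ℝ => p.1.2))
    · intro t ht
      have h := hm t ht
      rw [HnormSq_eq, inv_mul_le_iff₀ (by positivity)] at h
      refine le_trans (le_of_eq ?_) h
      congr 1; ext p
      exact abs_of_nonneg (div_nonneg (sq_nonneg _) (M1_pos _).le)
  have mp1 := (measurePreserving_prodAssoc (volume : Measure ℝ) bx (volume.restrict (Icc a b))).symm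
  have mp2 := (Measure.measurePreserving_swap (μ := (volume : Measure ℝ)) (ν := bx)).prod
    (MeasurePreserving.id (volume.restrict (Icc a b)))
  have mp := mp2.comp mp1
  exact (mp.integrable_comp h1.aestronglyMeasurable).2 h1

lemma pow_int (S : Sol g gx) (ha : 0 ≤ a)
    (hm : ∀ t ∈ Icc a b, HnormSq (fun x v => g x v t) ≤ m) (j : ℕ) :
    Integrable (fun p : ℝ × ℝ × ℝ => p.1 ^ j * g p.2.1 p.1 p.2.2)
      ((volume : Measure ℝ).prod (bx.prod (volume.restrict (Icc a b)))) := by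
  have h1 : Integrable (fun p : ℝ × ℝ × ℝ => (p.1 ^ (2 * j) * M1 p.1) * (1:ℝ))
      ((volume : Measure ℝ).prod (bx.prod (volume.restrict (Icc a b)))) :=
    (M1_pow_integrable (2 * j)).mul_prod (integrable_const (1:ℝ))
  refine ((S.sq_int ha hm).add h1).mono' ?_ (Eventually.of_forall fun p => ?_)
  · have hg : Measurable fun p : ℝ × ℝ × ℝ => g p.2.1 p.1 p.2.2 :=
      S.meas.comp (by fun_prop : Measurable fun p : ℝ × ℝ × ℝ => (p.2.1, p.1, p.2.2))
    exact Measurable.aestronglyMeasurable ((measurable_fst.pow_const j).mul hg)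
  · simpa using pow_mul_le j p.1 (g p.2.1 p.1 p.2.2)

lemma rho_meas (S : Sol g gx) : Measurable (fun p : ℝ × ℝ => ∫ w, g p.1 w p.2) := by
  have : StronglyMeasurable (fun q : (ℝ × ℝ) × ℝ => g q.1.1 q.2 q.1.2) := by
    have hg : Measurable fun q : (ℝ × ℝ) × ℝ => g q.1.1 q.2 q.1.2 :=
      S.meas.comp (by fun_prop : Measurable fun q : (ℝ × ℝ) × ℝ => (q.1.1, q.2, q.1.2))
    exact hg.stronglyMeasurable
  exact (StronglyMeasurable.integral_prod_right' this).measurable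

lemma amp_eq (S : Sol g gx) (ha : 0 ≤ a) (hab : a < b)
    (hm : ∀ t ∈ Icc a b, HnormSq (fun x v => g x v t) ≤ m) {ψ ψ' : ℝ → ℝ} {K : ℝ}
    (hψ : ∀ x, HasDerivAt ψ (ψ' x) x) (hψ' : Continuous ψ') (hK : ∀ x, |ψ x| ≤ K)
    (hK' : ∀ x, |ψ' x| ≤ K) (hp : ∀ x, ψ (x + 2 * π) = ψ x) (hp' : ∀ x, ψ' (x + 2 * π) = ψ' x) :
    ∀ᵐ v, ∀ t ∈ Icc a b, Amp ψ (fun x v => g x v t) v - Amp ψ (fun x v => g x v a) v =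
      ∫ τ in a..t, (M1 v * (∫ w, w ^ 0 * Amp ψ (fun x v => g x v τ) w) -
        Amp ψ (fun x v => g x v τ) v + v * Amp ψ' (fun x v => g x v τ) v) := by
  have hcψ : Continuous ψ := continuous_iff_continuousAt.2 fun x => (hψ x).continuousAt
  have hv0 : ∀ᵐ v : ℝ, v ≠ 0 := by
    rw [ae_iff]; simp
  have D2 := S.pow_int ha hm 0
  simp only [pow_zero, one_mul] at D2
  have D3 : Integrable (fun q : ℝ × ℝ => ∫ w, g q.1 w q.2) (bx.prod (volume.restrict (Icc a b))) :=
    D2.integral_prod_right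
  have D4 := D2.prod_right_ae
  filter_upwards [hv0, D4, S.derx, S.dert] with v hv hD hdx hdt t ht
  have hgm : Measurable (fun p : ℝ × ℝ => g p.1 v p.2) :=
    S.meas.comp (by fun_prop : Measurable fun p : ℝ × ℝ => (p.1, v, p.2))
  let Γ : ℝ → ℝ → ℝ := fun x t => ψ x * (M1 v * (∫ w, g x w t)) - ψ x * g x v t + v * (ψ' x * g x v t)
  have bψ : ∀ {F : ℝ × ℝ → ℝ}, Integrable F (bx.prod (volume.restrict (Icc a b))) →
      Integrable (fun p => ψ p.1 * F p) (bx.prod (volume.restrict (Icc a b))) := fun hF =>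
    hF.bdd_mul (c := K) (hcψ.measurable.comp measurable_fst).aestronglyMeasurable
      (Eventually.of_forall fun p => hK p.1)
  have bψ' : ∀ {F : ℝ × ℝ → ℝ}, Integrable F (bx.prod (volume.restrict (Icc a b))) →
      Integrable (fun p => ψ' p.1 * F p) (bx.prod (volume.restrict (Icc a b))) := fun hF =>
    hF.bdd_mul (c := K) (hψ'.measurable.comp measurable_fst).aestronglyMeasurable
      (Eventually.of_forall fun p => hK' p.1)
  have hmain := transport_int (u := fun x t => ψ x * g x v t)
    (ux := fun x t => ψ' x * g x v t + ψ x * gx x v t)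
    (ut := fun x t => ψ x * (M1 v * (∫ w, g x w t) - g x v t - v * gx x v t)) (Γ := Γ) hv hab
    (fun x t ht => (hψ x).mul (hdx x t (ha.trans ht.1)))
    (fun x t ht => ((hdt x t (ha.trans ht.1)).const_mul (ψ x)).mono fun s hs => ha.trans hs.1)
    (fun x t ht => by simp only [Γ]; ring)
    (fun x t => by simp only [hp, S.per])
    (fun x t => by simp only [Γ, hp, hp', S.per])
    (by
      refine Measurable.add (Measurable.sub ?_ ?_) ?_
      · exact (hcψ.measurable.comp measurable_fst).mul (S.rho_meas.const_mul _)
      · exact (hcψ.measurable.comp measurable_fst).mul hgm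
      · exact ((hψ'.measurable.comp measurable_fst).mul hgm).const_mul _)
    (by
      rw [IntegrableOn, Measure.volume_eq_prod, ← Measure.prod_restrict]
      exact ((bψ (D3.const_mul (M1 v))).sub (bψ hD)).add ((bψ' hD).const_mul v)) t ht
  have e0 : Amp ψ (fun x v => g x v t) v - Amp ψ (fun x v => g x v a) v = (2 * π)⁻¹ *
      ((∫ x in Ioc 0 (2*π), ψ x * g x v t) - (∫ x in Ioc 0 (2*π), ψ x * g x v a)) := by
    simp only [Amp, bx]; ring
  rw [e0, hmain, intervalIntegral.integral_of_le ht.1, intervalIntegral.integral_of_le ht.1,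
    ← integral_const_mul]
  have hae : ∀ᵐ τ ∂(volume.restrict (Icc a b)), Integrable (fun x => g x v τ) bx := hD.prod_left_ae
  have hae' : ∀ᵐ τ ∂(volume.restrict (Icc a b)), Integrable (fun x => ∫ w, g x w τ) bx := D3.prod_left_ae
  have hsub : Ioc a t ⊆ Icc a b := fun x hx => ⟨hx.1.le, hx.2.trans ht.2⟩
  apply integral_congr_ae
  filter_upwards [ae_restrict_of_ae_restrict_of_subset hsub hae,
    ae_restrict_of_ae_restrict_of_subset hsub hae', ae_restrict_mem measurableSet_Ioc] with τ h1 h2 h3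
  have c1 : Integrable (fun x => ψ x * g x v τ) bx :=
    h1.bdd_mul (c := K) hcψ.aestronglyMeasurable (Eventually.of_forall hK)
  have c2 : Integrable (fun x => v * (ψ' x * g x v τ)) bx :=
    (h1.bdd_mul (c := K) hψ'.aestronglyMeasurable (Eventually.of_forall hK')).const_mul v
  have c3 : Integrable (fun x => ψ x * (M1 v * ∫ w, g x w τ)) bx :=
    (h2.const_mul (M1 v)).bdd_mul (c := K) hcψ.aestronglyMeasurable (Eventually.of_forall hK)
  have c31 : Integrable (fun x => ψ x * (M1 v * ∫ w, g x w τ) - ψ x * g x v τ) bx := c3.sub c1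
  rw [mom0_eq (S.nice (ha.trans h3.1.le)) hcψ hK]
  have e1 : ∫ x in Ioc 0 (2 * π), Γ x τ = ∫ x, (ψ x * (M1 v * ∫ w, g x w τ) - ψ x * g x v τ +
    v * (ψ' x * g x v τ)) ∂bx := rfl
  have e2 : ∀ x, ψ x * (M1 v * ∫ w, g x w τ) = M1 v * (ψ x * ∫ w, g x w τ) := fun x => by ring
  rw [e1, integral_add c31 c2, integral_sub c3 c1, integral_const_mul]
  simp only [e2, Amp]
  rw [integral_const_mul]
  ring

end Sol


lemma anti_of {y y' : ℝ → ℝ} {a b : ℝ}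
    (hd : ∀ t ∈ Icc a b, HasDerivWithinAt y (y' t) (Icc a b) t) (h : ∀ t ∈ Icc a b, y' t ≤ 0) :
    AntitoneOn y (Icc a b) :=
  antitoneOn_of_hasDerivWithinAt_nonpos (convex_Icc a b) (fun t ht => (hd t ht).continuousWithinAt)
    (fun t ht => (hd t (interior_subset ht)).mono interior_subset)
    (fun t ht => h t (interior_subset ht))

lemma gronwall_anti {y y' : ℝ → ℝ} {a b l : ℝ}
    (hd : ∀ t ∈ Icc a b, HasDerivWithinAt y (y' t) (Icc a b) t)
    (h : ∀ t ∈ Icc a b, y' t ≤ -l * y t) :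
    AntitoneOn (fun t => Real.exp (l * t) * y t) (Icc a b) := by
  refine anti_of (y' := fun t => Real.exp (l * t) * l * y t + Real.exp (l * t) * y' t) ?_ ?_
  · intro t ht
    have h1 : HasDerivAt (fun t => Real.exp (l * t)) (Real.exp (l * t) * l) t := by
      have := ((hasDerivAt_id t).const_mul l).exp
      simpa using this
    exact h1.hasDerivWithinAt.mul (hd t ht)
  · intro t ht
    have := mul_le_mul_of_nonneg_left (h t ht) (Real.exp_pos (l * t)).le
    linarith

lemma amp_const_mul (r : ℝ) (ψ : ℝ → ℝ) (h : ℝ → ℝ → ℝ) (v : ℝ) :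
    Amp (fun x => r * ψ x) h v = r * Amp ψ h v := by
  simp only [Amp, mul_assoc]
  rw [integral_const_mul]; ring

lemma ck_der (k : ℤ) (x : ℝ) : HasDerivAt (ck k) (-k * sk k x) x := by
  have := ((hasDerivAt_id x).const_mul (k:ℝ)).cos
  unfold ck sk
  convert! this using 1
  simp only [id]; ring

lemma sk_der (k : ℤ) (x : ℝ) : HasDerivAt (sk k) (k * ck k x) x := by
  have := ((hasDerivAt_id x).const_mul (k:ℝ)).sin
  unfold ck sk
  convert! this using 1
  simp only [id]; ring

lemma ck_per (k : ℤ) (x : ℝ) : ck k (x + 2 * π) = ck k x := by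
  unfold ck
  rw [mul_add, Real.cos_add_int_mul_two_pi]

lemma sk_per (k : ℤ) (x : ℝ) : sk k (x + 2 * π) = sk k x := by
  unfold sk
  rw [mul_add, Real.sin_add_int_mul_two_pi]

lemma ck_le (k : ℤ) (x : ℝ) : |ck k x| ≤ 1 := Real.abs_cos_le_one _
lemma sk_le (k : ℤ) (x : ℝ) : |sk k x| ≤ 1 := Real.abs_sin_le_one _

lemma En_le {h : ℝ → ℝ → ℝ} (hn : Nice h) (k : ℤ) : En k h ≤ HnormSq h :=
  le_hasSum (parseval hn) k fun j _ => En_nonneg j h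

lemma En_split {h : ℝ → ℝ → ℝ} (hn : Nice h) (k : ℤ) :
    En k h = (∫ v, Amp (ck k) h v ^ 2 / M1 v) + ∫ v, Amp (sk k) h v ^ 2 / M1 v := by
  rw [← integral_add (ampc_int hn k) (amps_int hn k)]
  simp only [En, add_div]

namespace Sol
variable {g gx : ℝ → ℝ → ℝ → ℝ} {a b m : ℝ}

lemma amp_meas2 (S : Sol g gx) {ψ : ℝ → ℝ} (hψ : Continuous ψ) :
    Measurable (Function.uncurry fun v t => Amp ψ (fun x v => g x v t) v) := by
  have : StronglyMeasurable (fun q : (ℝ × ℝ) × ℝ => ψ q.2 * g q.2 q.1.1 q.1.2) := by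
    have hg : Measurable fun q : (ℝ × ℝ) × ℝ => g q.2 q.1.1 q.1.2 :=
      S.meas.comp (by fun_prop : Measurable fun q : (ℝ × ℝ) × ℝ => (q.2, q.1.1, q.1.2))
    exact ((hψ.measurable.comp measurable_snd).mul hg).stronglyMeasurable
  exact (StronglyMeasurable.integral_prod_right' (ν := bx) this).measurable.const_mul _

lemma mode (S : Sol g gx) (ha : 0 ≤ a) (hab : a < b)
    (hm : ∀ t ∈ Icc a b, HnormSq (fun x v => g x v t) ≤ m) (k : ℤ) :
    ModeHyp k a b m (fun v t => Amp (ck k) (fun x v => g x v t) v)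
      (fun v t => Amp (sk k) (fun x v => g x v t) v) where
  mc := S.amp_meas2 (ck_cont k)
  ms := S.amp_meas2 (sk_cont k)
  ic := fun t ht => ampc_int (S.nice (ha.trans ht.1)) k
  is := fun t ht => amps_int (S.nice (ha.trans ht.1)) k
  bc := fun t ht => by
    have hn := S.nice (ha.trans ht.1)
    have h1 := (En_le hn k).trans (hm t ht)
    rw [En_split hn] at h1
    have : 0 ≤ ∫ v, Amp (sk k) (fun x v => g x v t) v ^ 2 / M1 v :=
      integral_nonneg fun v => div_nonneg (sq_nonneg _) (M1_pos v).le
    linarith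
  bs := fun t ht => by
    have hn := S.nice (ha.trans ht.1)
    have h1 := (En_le hn k).trans (hm t ht)
    rw [En_split hn] at h1
    have : 0 ≤ ∫ v, Amp (ck k) (fun x v => g x v t) v ^ 2 / M1 v :=
      integral_nonneg fun v => div_nonneg (sq_nonneg _) (M1_pos v).le
    linarith
  eqc := by
    have := S.amp_eq ha hab hm (ψ := ck k) (ψ' := fun x => -k * sk k x) (K := 1 + |(k:ℝ)|)
      (ck_der k) (continuous_const.mul (sk_cont k))
      (fun x => (ck_le k x).trans (by linarith [abs_nonneg (k:ℝ)]))
      (fun x => by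
        rw [abs_mul, abs_neg]
        nlinarith [sk_le k x, abs_nonneg (k:ℝ)])
      (ck_per k) (fun x => by rw [sk_per])
    filter_upwards [this] with v hv t ht
    rw [hv t ht]
    congr 1; ext τ
    rw [amp_const_mul]; ring
  eqs := by
    have := S.amp_eq ha hab hm (ψ := sk k) (ψ' := fun x => k * ck k x) (K := 1 + |(k:ℝ)|)
      (sk_der k) (continuous_const.mul (ck_cont k))
      (fun x => (sk_le k x).trans (by linarith [abs_nonneg (k:ℝ)]))
      (fun x => by
        rw [abs_mul]
        nlinarith [ck_le k x, abs_nonneg (k:ℝ)])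
      (sk_per k) (fun x => by rw [ck_per])
    filter_upwards [this] with v hv t ht
    rw [hv t ht]
    congr 1; ext τ
    rw [amp_const_mul]; ring

lemma En_deriv (S : Sol g gx) (ha : 0 ≤ a) (hab : a < b)
    (hm : ∀ t ∈ Icc a b, HnormSq (fun x v => g x v t) ≤ m) (k : ℤ) :
    ∀ t ∈ Icc a b, HasDerivWithinAt (fun t => En k (fun x v => g x v t))
      (2 * Mom 0 (ck k) (fun x v => g x v t) ^ 2 + 2 * Mom 0 (sk k) (fun x v => g x v t) ^ 2
        - 2 * En k (fun x v => g x v t)) (Icc a b) t :=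
  (S.mode ha hab hm k).energy_deriv hab.le

lemma En_comp (S : Sol g gx) (ha : 0 ≤ a) (hab : a < b)
    (hm : ∀ t ∈ Icc a b, HnormSq (fun x v => g x v t) ≤ m) (k : ℤ) {t t' : ℝ}
    (ht : t ∈ Icc a b) (ht' : t' ∈ Icc a b) :
    En k (fun x v => g x v t) ≤ Real.exp (2 * b) * En k (fun x v => g x v t') := by
  have hd := S.En_deriv ha hab hm k
  have hb : (1:ℝ) ≤ Real.exp (2 * b) := Real.one_le_exp (by linarith)
  have h0 := En_nonneg k (fun x v => g x v t')
  rcases le_total t' t with h | h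
  · have := anti_of hd (fun t ht => by
      have := bessel_En (S.nice (ha.trans ht.1)) k
      nlinarith) ht' ht h
    simp only at this
    nlinarith
  · have := gronwall_anti (l := 2) (y := fun t => - En k (fun x v => g x v t))
      (fun t ht => (hd t ht).neg) (fun t ht => by
        nlinarith [sq_nonneg (Mom 0 (ck k) (fun x v => g x v t)),
          sq_nonneg (Mom 0 (sk k) (fun x v => g x v t))]) ht ht' h
    simp only at this
    have h1 : 1 ≤ Real.exp (2 * t) := Real.one_le_exp (by linarith [ht.1])
    have h2 : Real.exp (2 * t') ≤ Real.exp (2 * b) := Real.exp_le_exp.2 (by linarith [ht'.2])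
    nlinarith [En_nonneg k (fun x v => g x v t)]

lemma N_closed (S : Sol g gx) (T : ℝ) (m : ℕ) :
    IsClosed {t | t ∈ Icc 0 T ∧ HnormSq (fun x v => g x v t) ≤ m} := by
  apply IsSeqClosed.isClosed
  intro u t hu hlim
  have htI : t ∈ Icc 0 T := isClosed_Icc.mem_of_tendsto hlim (Eventually.of_forall fun n => (hu n).1)
  refine ⟨htI, ?_⟩
  have key : ∀ s, 0 ≤ s → (HnormSq (fun x v => g x v s) ≤ m ↔
      ∫⁻ p, ENNReal.ofReal (g p.1 p.2 s ^ 2 / M1 p.2) ∂(bx.prod volume) ≤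
        ENNReal.ofReal (2 * π * m)) := by
    intro s hs
    rw [HnormSq_eq, inv_mul_le_iff₀ (by positivity), ← ofReal_integral_eq_lintegral_ofReal (S.int s hs)
      (Eventually.of_forall fun p => div_nonneg (sq_nonneg _) (M1_pos _).le),
      ENNReal.ofReal_le_ofReal_iff (by positivity)]
  rw [key t htI.1]
  have hc : ∀ᵐ p ∂(bx.prod (volume : Measure ℝ)), Tendsto (fun n => ENNReal.ofReal (g p.1 p.2 (u n) ^ 2 / M1 p.2))
      atTop (𝓝 (ENNReal.ofReal (g p.1 p.2 t ^ 2 / M1 p.2))) := by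
    have h1 := Measure.quasiMeasurePreserving_snd (μ := bx) (ν := (volume : Measure ℝ))
    filter_upwards [h1.ae S.dert] with p hp
    have h2 := (hp p.1 t htI.1).continuousWithinAt
    have h3 : Tendsto u atTop (𝓝[Ici 0] t) :=
      tendsto_nhdsWithin_iff.2 ⟨hlim, Eventually.of_forall fun n => (hu n).1.1⟩
    have h4 : Tendsto (fun n => g p.1 p.2 (u n)) atTop (𝓝 (g p.1 p.2 t)) := h2.tendsto.comp h3
    exact (ENNReal.continuous_ofReal.tendsto _).comp ((h4.pow 2).div_const _)
  calc ∫⁻ p, ENNReal.ofReal (g p.1 p.2 t ^ 2 / M1 p.2) ∂(bx.prod volume)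
      = ∫⁻ p, liminf (fun n => ENNReal.ofReal (g p.1 p.2 (u n) ^ 2 / M1 p.2)) atTop ∂(bx.prod volume) := by
        apply lintegral_congr_ae
        filter_upwards [hc] with p hp using hp.liminf_eq.symm
    _ ≤ liminf (fun n => ∫⁻ p, ENNReal.ofReal (g p.1 p.2 (u n) ^ 2 / M1 p.2) ∂(bx.prod volume)) atTop := by
        apply lintegral_liminf_le
        intro n
        exact (((S.nice (hu n).1.1).meas.pow_const 2).div
          (M1_measurable.comp measurable_snd)).ennreal_ofReal
    _ ≤ _ := by
        refine (liminf_le_limsup).trans (limsup_le_of_le (h := Eventually.of_forall fun n => ?_))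
        exact (key _ (hu n).1.1).1 (hu n).2

lemma bdd (S : Sol g gx) (T : ℝ) : ∃ m : ℝ, ∀ t ∈ Icc 0 T, HnormSq (fun x v => g x v t) ≤ m := by
  rcases lt_or_ge T 0 with hT | hT
  · exact ⟨0, fun t ht => absurd (ht.1.trans ht.2) (not_le.2 hT)⟩
  refine time_baire (N := fun t => HnormSq (fun x v => g x v t)) (C := Real.exp (2 * T))
    (Real.one_le_exp (by linarith)) (fun t => HnormSq_nonneg _) (S.N_closed T) ?_
  rintro a b ha hab hbT ⟨m, hm⟩ t ht t' ht'
  have hn := S.nice (ha.trans ht.1)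
  have hn' := S.nice (ha.trans ht'.1)
  rcases hab.eq_or_lt with rfl | hab
  · have e : t = t' := le_antisymm (ht.2.trans ht'.1) (ht'.2.trans ht.1)
    subst e
    have := HnormSq_nonneg (fun x v => g x v t)
    have h1 : (1:ℝ) ≤ Real.exp (2 * T) := Real.one_le_exp (by linarith)
    nlinarith
  · refine hasSum_le (fun k => ?_) (parseval hn) ((parseval hn').mul_left _)
    refine (S.En_comp ha hab hm k ht ht').trans ?_
    have := En_nonneg k (fun x v => g x v t')
    gcongr

end Sol


lemma quad_aux {r c0 s0 c1 s1 dc ds : ℝ} (hr : |r| ≤ 1) :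
    0 ≤ 0.3925 * (c0 ^ 2 + s0 ^ 2) + 0.5125 * (c1 ^ 2 + s1 ^ 2) + 0.72625 * (dc ^ 2 + ds ^ 2)
      + 0.94 * (c0 * dc + s0 * ds) - 0.94 * 0.4525 * r * (c0 * s1 - s0 * c1) := by
  have hr2 : r ^ 2 ≤ 1 := by
    rw [← sq_abs]; nlinarith [abs_nonneg r]
  have e : 0.3925 * (c0 ^ 2 + s0 ^ 2) + 0.5125 * (c1 ^ 2 + s1 ^ 2) + 0.72625 * (dc ^ 2 + ds ^ 2)
      + 0.94 * (c0 * dc + s0 * ds) - 0.94 * 0.4525 * r * (c0 * s1 - s0 * c1) =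
      0.72625 * ((dc + 0.47 / 0.72625 * c0) ^ 2 + (ds + 0.47 / 0.72625 * s0) ^ 2)
      + 0.5125 * ((s1 - 0.47 * 0.4525 / 0.5125 * r * c0) ^ 2 + (c1 + 0.47 * 0.4525 / 0.5125 * r * s0) ^ 2)
      + (0.3925 - 0.47 ^ 2 / 0.72625 - (0.47 * 0.4525) ^ 2 / 0.5125 * r ^ 2) * (c0 ^ 2 + s0 ^ 2) := by
    ring
  rw [e]
  have h1 : (0:ℝ) ≤ 0.3925 - 0.47 ^ 2 / 0.72625 - (0.47 * 0.4525) ^ 2 / 0.5125 * r ^ 2 := by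
    have : ((0.47 * 0.4525) ^ 2 / 0.5125 * r ^ 2 : ℝ) ≤ (0.47 * 0.4525) ^ 2 / 0.5125 * 1 := by gcongr
    have h2 : (0:ℝ) ≤ 0.3925 - 0.47 ^ 2 / 0.72625 - (0.47 * 0.4525) ^ 2 / 0.5125 * 1 := by norm_num
    linarith
  have h3 : 0 ≤ c0 ^ 2 + s0 ^ 2 := by positivity
  have := mul_nonneg h1 h3
  positivity

namespace Sol
variable {g gx : ℝ → ℝ → ℝ → ℝ} {a b m : ℝ}

lemma c_deriv (S : Sol g gx) (ha : 0 ≤ a) (hab : a < b)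
    (hm : ∀ t ∈ Icc a b, HnormSq (fun x v => g x v t) ≤ m) (k : ℤ) (j : ℕ) :
    ∀ t ∈ Icc a b, HasDerivWithinAt (fun t => Mom j (ck k) (fun x v => g x v t))
      ((∫ v, v ^ j * M1 v) * Mom 0 (ck k) (fun x v => g x v t) - Mom j (ck k) (fun x v => g x v t)
        - k * Mom (j + 1) (sk k) (fun x v => g x v t)) (Icc a b) t :=
  (S.mode ha hab hm k).mom_deriv hab.le j

lemma s_deriv (S : Sol g gx) (ha : 0 ≤ a) (hab : a < b)
    (hm : ∀ t ∈ Icc a b, HnormSq (fun x v => g x v t) ≤ m) (k : ℤ) (j : ℕ) :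
    ∀ t ∈ Icc a b, HasDerivWithinAt (fun t => Mom j (sk k) (fun x v => g x v t))
      ((∫ v, v ^ j * M1 v) * Mom 0 (sk k) (fun x v => g x v t) - Mom j (sk k) (fun x v => g x v t)
        - (-k) * Mom (j + 1) (ck k) (fun x v => g x v t)) (Icc a b) t :=
  (S.mode ha hab hm k).symm.mom_deriv hab.le j

lemma ek_anti (S : Sol g gx) {T : ℝ} (hT : 0 < T) {k : ℤ} (hk : k ≠ 0) :
    AntitoneOn (fun t => Real.exp (0.5475 * t) * ek k (fun x v => g x v t)) (Icc 0 T) := by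
  obtain ⟨m, hm⟩ := S.bdd T
  have hE := S.En_deriv le_rfl hT hm k
  have hC := S.c_deriv le_rfl hT hm k
  have hS := S.s_deriv le_rfl hT hm k
  have hX : ∀ t ∈ Icc 0 T, HasDerivWithinAt (fun t => Xk k (fun x v => g x v t)) _ (Icc 0 T) t :=
    fun t ht => ((hC 0 t ht).mul (hS 1 t ht)).sub ((hS 0 t ht).mul (hC 1 t ht))
  refine gronwall_anti (fun t ht => (hE t ht).sub ((hX t ht).const_mul (2 * 0.47 / (k:ℝ)))) ?_
  intro t ht
  have hb := bessel_En (S.nice ht.1) k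
  have hkr : (k:ℝ) ≠ 0 := by exact_mod_cast hk
  have hq := quad_aux (r := (k:ℝ)⁻¹) (c0 := Mom 0 (ck k) (fun x v => g x v t))
    (s0 := Mom 0 (sk k) (fun x v => g x v t)) (c1 := Mom 1 (ck k) (fun x v => g x v t))
    (s1 := Mom 1 (sk k) (fun x v => g x v t))
    (dc := Mom 2 (ck k) (fun x v => g x v t) - Mom 0 (ck k) (fun x v => g x v t))
    (ds := Mom 2 (sk k) (fun x v => g x v t) - Mom 0 (sk k) (fun x v => g x v t)) (inv_int_abs_le k)
  simp only [M1_m0, M1_m1, zero_add, Nat.reduceAdd, ek, Xk]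
  generalize Mom 0 (ck k) (fun x v => g x v t) = c0 at *
  generalize Mom 0 (sk k) (fun x v => g x v t) = s0 at *
  generalize Mom 1 (ck k) (fun x v => g x v t) = c1 at *
  generalize Mom 1 (sk k) (fun x v => g x v t) = s1 at *
  generalize Mom 2 (ck k) (fun x v => g x v t) = c2 at *
  generalize Mom 2 (sk k) (fun x v => g x v t) = s2 at *
  generalize En k (fun x v => g x v t) = E at *
  have hr : (k:ℝ) * (k:ℝ)⁻¹ = 1 := mul_inv_cancel₀ hkr
  rw [div_eq_mul_inv]
  generalize (k:ℝ)⁻¹ = r at *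
  generalize (k:ℝ) = κ at *
  have e : 2 * 0.47 * r * ((1 * c0 - c0 - κ * s1) * s1 + c0 * (0 * s0 - s1 - -κ * c2) -
      ((1 * s0 - s0 - -κ * c1) * c1 + s0 * (0 * c0 - c1 - κ * s2))) =
      0.94 * (κ * r) * (c0 * c2 + s0 * s2 - c1 ^ 2 - s1 ^ 2) - 0.94 * r * (c0 * s1 - s0 * c1) := by ring
  rw [e, hr]
  nlinarith [hb, hq]

lemma mom_zero (S : Sol g gx) {T : ℝ} (hT : 0 < T) (h0 : Mom 0 (ck 0) (fun x v => g x v 0) = 0) :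
    ∀ t ∈ Icc 0 T, Mom 0 (ck 0) (fun x v => g x v t) = 0 := by
  obtain ⟨m, hm⟩ := S.bdd T
  have hC := S.c_deriv le_rfl hT hm 0 0
  have hC' : ∀ t ∈ Icc 0 T, HasDerivWithinAt (fun t => Mom 0 (ck 0) (fun x v => g x v t)) 0 (Icc 0 T) t := by
    intro t ht
    have := hC t ht
    simpa [M1_integral] using this
  intro t ht
  have h1 := anti_of hC' (fun _ _ => le_rfl) ⟨le_rfl, hT.le⟩ ht ht.1
  have h2 := anti_of (fun t ht => (hC' t ht).neg) (fun _ _ => by simp) ⟨le_rfl, hT.le⟩ ht ht.1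
  simp only at h1
  have h3 : -Mom 0 (ck 0) (fun x v => g x v t) ≤ -Mom 0 (ck 0) (fun x v => g x v 0) := h2
  linarith

lemma ek_zero_anti (S : Sol g gx) {T : ℝ} (hT : 0 < T)
    (h0 : Mom 0 (ck 0) (fun x v => g x v 0) = 0) :
    AntitoneOn (fun t => Real.exp (0.5475 * t) * ek 0 (fun x v => g x v t)) (Icc 0 T) := by
  obtain ⟨m, hm⟩ := S.bdd T
  have hE := S.En_deriv le_rfl hT hm 0
  have e : ∀ h, ek 0 h = En 0 h := fun h => by simp [ek]
  simp only [e]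
  refine gronwall_anti hE fun t ht => ?_
  rw [S.mom_zero hT h0 t ht]
  have hs : Mom 0 (sk 0) (fun x v => g x v t) = 0 := by simp [Mom, Amp, sk]
  rw [hs]
  have := En_nonneg 0 (fun x v => g x v t)
  norm_num
  linarith

lemma decay (S : Sol g gx) (h0 : Mom 0 (ck 0) (fun x v => g x v 0) = 0) {t : ℝ} (ht : 0 ≤ t) :
    ∑' k, ek k (fun x v => g x v t) ≤ Real.exp (-0.5475 * t) * ∑' k, ek k (fun x v => g x v 0) := by
  rcases ht.eq_or_lt with rfl | ht
  · simp
  rw [← tsum_mul_left]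
  refine (ek_summable (S.nice ht.le)).tsum_le_tsum (fun k => ?_) ((ek_summable (S.nice le_rfl)).mul_left _)
  have h1 : Real.exp (0.5475 * t) * ek k (fun x v => g x v t) ≤ ek k (fun x v => g x v 0) := by
    by_cases hk : k = 0
    · subst hk
      have := S.ek_zero_anti ht h0 ⟨le_rfl, ht.le⟩ ⟨ht.le, le_rfl⟩ ht.le
      simpa using this
    · have := S.ek_anti ht hk ⟨le_rfl, ht.le⟩ ⟨ht.le, le_rfl⟩ ht.le
      simpa using this
  have h2 : Real.exp (-0.5475 * t) * Real.exp (0.5475 * t) = 1 := by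
    rw [← Real.exp_add]; simp
  calc ek k (fun x v => g x v t)
      = Real.exp (-0.5475 * t) * (Real.exp (0.5475 * t) * ek k (fun x v => g x v t)) := by
        rw [← mul_assoc, h2, one_mul]
    _ ≤ _ := by gcongr

end Sol


lemma meas_of_rat {F : ℝ → ℝ → ℝ} (hc : ∀ v, Continuous fun x => F x v)
    (hm : ∀ q : ℚ, Measurable (F q)) (x : ℝ) : Measurable (F x) := by
  have hx : x ∈ closure (range ((↑) : ℚ → ℝ)) := Rat.denseRange_cast x
  obtain ⟨u, hu, hl⟩ := mem_closure_iff_seq_limit.1 hx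
  refine measurable_of_tendsto_metrizable (f := fun n => F (u n)) (fun n => ?_)
    (tendsto_pi_nhds.2 fun v => ((hc v).tendsto x).comp hl)
  obtain ⟨q, hq⟩ := hu n
  rw [← hq]; exact hm q

section setup
variable {f fx : ℝ → ℝ → ℝ → ℝ}

lemma exists_null (hintg : ∀ x t : ℝ, 0 ≤ t → Integrable (fun w : ℝ => f x w t)) :
    ∃ Z : Set ℝ, MeasurableSet Z ∧ volume Z = 0 ∧ ∀ q τ : ℚ,
      Measurable fun v => Zᶜ.indicator (fun v => f q v (max τ 0) - M1 v) v := by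
  have ha : ∀ p : ℚ × ℚ, AEMeasurable (fun w => f p.1 w (max p.2 0)) :=
    fun p => (hintg p.1 (max p.2 0) (le_max_right _ _)).aestronglyMeasurable.aemeasurable
  have hae : ∀ᵐ w, ∀ p : ℚ × ℚ, f p.1 w (max p.2 0) = (ha p).mk _ w :=
    ae_all_iff.2 fun p => (ha p).ae_eq_mk
  refine ⟨toMeasurable volume {w | ¬ ∀ p : ℚ × ℚ, f p.1 w (max p.2 0) = (ha p).mk _ w},
    measurableSet_toMeasurable _ _, ?_, ?_⟩
  · rw [measure_toMeasurable]; exact hae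
  · intro q τ
    have e : (fun v => (toMeasurable volume {w | ¬ ∀ p : ℚ × ℚ, f p.1 w (max p.2 0) = (ha p).mk _ w})ᶜ.indicator
        (fun v => f q v (max τ 0) - M1 v) v) =
        (toMeasurable volume {w | ¬ ∀ p : ℚ × ℚ, f p.1 w (max p.2 0) = (ha p).mk _ w})ᶜ.indicator
        (fun v => (ha (q, τ)).mk _ v - M1 v) := by
      apply indicator_congr
      intro w hw
      have : ¬ ¬ ∀ p : ℚ × ℚ, f p.1 w (max p.2 0) = (ha p).mk _ w := fun h =>
        hw (subset_toMeasurable _ _ h)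
      exact congrArg (fun y => y - M1 w) ((not_not.1 this) (q, τ))
    rw [e]
    exact ((ha (q, τ)).measurable_mk.sub M1_measurable).indicator (measurableSet_toMeasurable _ _).compl

lemma exists_sol (hper : ∀ x v t : ℝ, f (x + 2 * π) v t = f x v t)
    (hdx : ∀ x v t : ℝ, 0 ≤ t → HasDerivAt (fun y => f y v t) (fx x v t) x)
    (hdt : ∀ x v t : ℝ, 0 ≤ t → HasDerivAt (fun s => f x v s)
            (M1 v * (∫ w : ℝ, f x w t) - f x v t - v * fx x v t) t)
    (hintg : ∀ x t : ℝ, 0 ≤ t → Integrable (fun w : ℝ => f x w t))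
    (hsq : ∀ t : ℝ, 0 ≤ t → Integrable
            (fun p : ℝ × ℝ => (f p.1 p.2 t - M1 p.2) ^ 2 / M1 p.2) (bx.prod volume)) :
    ∃ g, Sol g fx ∧ ∀ t, 0 ≤ t → ∀ᵐ p ∂(bx.prod (volume : Measure ℝ)),
      f p.1 p.2 t - M1 p.2 = g p.1 p.2 t := by
  obtain ⟨Z, hZm, hZ0, hZ⟩ := exists_null hintg
  have hZae : ∀ᵐ v, v ∉ Z := measure_eq_zero_iff_ae_notMem.1 hZ0
  let g : ℝ → ℝ → ℝ → ℝ := fun x v t => Zᶜ.indicator (fun v => f x v (max t 0) - M1 v) v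
  have gin : ∀ {v}, v ∈ Z → ∀ x t, g x v t = 0 := fun hv x t => indicator_of_notMem (by simpa using hv) _
  have gout : ∀ {v}, v ∉ Z → ∀ x t, g x v t = f x v (max t 0) - M1 v :=
    fun hv x t => indicator_of_mem (by simpa using hv) _
  have gout' : ∀ {v}, v ∉ Z → ∀ x t, 0 ≤ t → g x v t = f x v t - M1 v :=
    fun hv x t ht => by rw [gout hv, max_eq_left ht]
  have cx : ∀ v t, Continuous fun x => g x v t := by
    intro v t
    by_cases hv : v ∈ Z
    · simp only [gin hv]; exact continuous_const
    · simp only [gout hv]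
      refine Continuous.sub (continuous_iff_continuousAt.2 fun x => ?_) continuous_const
      exact (hdx x v (max t 0) (le_max_right _ _)).continuousAt
  have ct : ∀ x v, Continuous fun t => g x v t := by
    intro x v
    by_cases hv : v ∈ Z
    · simp only [gin hv]; exact continuous_const
    · simp only [gout hv]
      refine Continuous.sub (continuous_iff_continuousAt.2 fun t => ?_) continuous_const
      exact ContinuousAt.comp (f := fun t : ℝ => max t 0) (g := fun s => f x v s)
        (hdt x v (max t 0) (le_max_right _ _)).continuousAt
        ((continuous_id.max continuous_const).continuousAt)
  have m1 : ∀ (q : ℚ) (t : ℝ), Measurable fun v => g q v t := fun q t =>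
    meas_of_rat (F := fun t v => g q v t) (fun v => ct q v) (fun τ => hZ q τ) t
  have m2 : ∀ x t : ℝ, Measurable fun v => g x v t := fun x t =>
    meas_of_rat (F := fun x v => g x v t) (fun v => cx v t) (fun q => m1 q t) x
  have m3 : ∀ t, Measurable (Function.uncurry fun x v => g x v t) := fun t =>
    measurable_uncurry_of_continuous_of_measurable (fun v => cx v t) (fun x => m2 x t)
  have m4 : Measurable (Function.uncurry fun (t : ℝ) (p : ℝ × ℝ) => g p.1 p.2 t) :=
    measurable_uncurry_of_continuous_of_measurable (fun p => ct p.1 p.2) (fun t => m3 t)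
  have hae : ∀ t, 0 ≤ t → ∀ᵐ p ∂(bx.prod (volume : Measure ℝ)), f p.1 p.2 t - M1 p.2 = g p.1 p.2 t := by
    intro t ht
    have h1 := Measure.quasiMeasurePreserving_snd (μ := bx) (ν := (volume : Measure ℝ))
    filter_upwards [h1.ae hZae] with p hp
    rw [gout' hp _ _ ht]
  refine ⟨g, ⟨?_, ?_, ?_, ?_, ?_⟩, hae⟩
  · exact m4.comp (by fun_prop : Measurable fun p : ℝ × ℝ × ℝ => (p.2.2, (p.1, p.2.1)))
  · intro x v t
    by_cases hv : v ∈ Z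
    · rw [gin hv, gin hv]
    · rw [gout hv, gout hv, hper]
  · filter_upwards [hZae] with v hv x t ht
    have : (fun y => g y v t) = fun y => f y v t - M1 v := funext fun y => gout' hv y t ht
    rw [this]
    exact (hdx x v t ht).sub_const _
  · filter_upwards [hZae] with v hv x t ht
    have e : ∫ w, g x w t = (∫ w, f x w t) - 1 := by
      rw [← M1_integral, ← integral_sub (hintg x t ht) M1_integrable]
      apply integral_congr_ae
      filter_upwards [hZae] with w hw using gout' hw x t ht
    have e2 : M1 v * (∫ w, g x w t) - g x v t - v * fx x v t =
        M1 v * (∫ w, f x w t) - f x v t - v * fx x v t := by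
      rw [e, gout' hv x t ht]; ring
    rw [e2]
    exact ((hdt x v t ht).sub_const (M1 v)).hasDerivWithinAt.congr (fun s hs => gout' hv x s hs)
      (gout' hv x t ht)
  · intro t ht
    refine (hsq t ht).congr ?_
    filter_upwards [hae t ht] with p hp
    rw [hp]

lemma ent_eq {h h' : ℝ → ℝ → ℝ} (hm : Measurable (Function.uncurry h'))
    (he : ∀ᵐ p ∂(bx.prod (volume : Measure ℝ)), h p.1 p.2 - M1 p.2 = h' p.1 p.2) :
    ent h = ∑' k, ek k h' := by
  have ham : AEMeasurable (fun p : ℝ × ℝ => h p.1 p.2 - M1 p.2) (bx.prod volume) :=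
    ⟨Function.uncurry h', hm, he⟩
  rw [ent, if_pos ham]
  exact tsum_congr fun k => ek_congr (h := fun x v => h x v - M1 v) he k

lemma norm_zero {h h' : ℝ → ℝ → ℝ} (hn : Nice h')
    (he : ∀ᵐ p ∂(bx.prod (volume : Measure ℝ)), h p.1 p.2 - M1 p.2 = h' p.1 p.2)
    (h1 : (2 * π)⁻¹ * ∫ p, h p.1 p.2 ∂(bx.prod volume) = 1) : Mom 0 (ck 0) h' = 0 := by
  have hi := nice_pow hn 0
  simp only [pow_zero, one_mul] at hi
  have hM : Integrable (fun p : ℝ × ℝ => (1:ℝ) * M1 p.2) (bx.prod volume) :=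
    (integrable_const (1:ℝ)).mul_prod M1_integrable
  have e1 : ∫ p, h p.1 p.2 ∂(bx.prod volume) = (∫ p, h' p.1 p.2 ∂(bx.prod volume)) + 2 * π := by
    have e2 : ∫ p : ℝ × ℝ, (1:ℝ) * M1 p.2 ∂(bx.prod volume) = 2 * π := by
      rw [integral_prod_mul (fun _ => (1:ℝ)) M1, M1_integral, bx]
      simp [Real.pi_pos.le]
    rw [← e2, ← integral_add hi hM]
    apply integral_congr_ae
    filter_upwards [he] with p hp
    rw [← hp]; ring
  have e3 : Mom 0 (ck 0) h' = (2 * π)⁻¹ * ∫ p, h' p.1 p.2 ∂(bx.prod volume) := by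
    rw [Mom, mom0_eq hn (ck_cont 0) (ck_le 0), integral_prod _ hi]
    simp [ck]
  rw [e1, mul_add, inv_mul_cancel₀ (by positivity)] at h1
  rw [e3]; linarith

end setup

end BGK

/-- Theorem 1, decay estimate for the linear BGK equation
`∂_t f + v ∂_x f = M₁(v) ∫ f dv' - f` on `𝕋¹ × ℝ`: there is an entropy functional
`e` with `(1/2) e(f) ≤ ‖f - M₁‖²_ℋ ≤ 4 e(f)` such that every normalized classical
solution satisfies `e(f(t)) ≤ e^{-0.5475 t} e(f^I)` for `t ≥ 0`. -/
theorem stmt_18 :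
    ∃ e : (ℝ → ℝ → ℝ) → ℝ,
      -- norm equivalence on densities `g` with `g - M₁ ∈ ℋ`
      (∀ g : ℝ → ℝ → ℝ,
        (∀ x v : ℝ, g (x + 2 * Real.pi) v = g x v) →
        IntegrableOn (fun p : ℝ × ℝ => (g p.1 p.2 - M1 p.2) ^ 2 / M1 p.2)
          ((Set.Ioc (0:ℝ) (2 * Real.pi)) ×ˢ (Set.univ : Set ℝ)) →
        (1/2) * e g ≤ HnormSq (fun x v => g x v - M1 v) ∧
          HnormSq (fun x v => g x v - M1 v) ≤ 4 * e g) ∧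
      -- exponential decay along solutions of the BGK equation
      (∀ f fx : ℝ → ℝ → ℝ → ℝ,
        (∀ x v t : ℝ, f (x + 2 * Real.pi) v t = f x v t) →
        (∀ x v t : ℝ, 0 ≤ t → HasDerivAt (fun y => f y v t) (fx x v t) x) →
        (∀ x v t : ℝ, 0 ≤ t → HasDerivAt (fun s => f x v s)
            (M1 v * (∫ w : ℝ, f x w t) - f x v t - v * fx x v t) t) →
        (∀ x t : ℝ, 0 ≤ t → Integrable (fun w : ℝ => f x w t)) →
        (∀ t : ℝ, 0 ≤ t → IntegrableOn
            (fun p : ℝ × ℝ => (f p.1 p.2 t - M1 p.2) ^ 2 / M1 p.2)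
            ((Set.Ioc (0:ℝ) (2 * Real.pi)) ×ˢ (Set.univ : Set ℝ))) →
        ((2 * Real.pi)⁻¹ *
            ∫ p in (Set.Ioc (0:ℝ) (2 * Real.pi)) ×ˢ (Set.univ : Set ℝ), f p.1 p.2 0) = 1 →
        ∀ t : ℝ, 0 ≤ t →
          e (fun x v => f x v t) ≤ Real.exp (-(0.5475) * t) * e (fun x v => f x v 0)) := by
  refine ⟨BGK.ent, ?_, ?_⟩
  · intro g _ hi
    rw [IntegrableOn, BGK.box_eq] at hi
    exact BGK.ent_equiv g hi
  · intro f fx hper hdx hdt hintg hsq h1 t ht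
    rw [BGK.box_eq] at h1
    have hsq' : ∀ t : ℝ, 0 ≤ t → Integrable
        (fun p : ℝ × ℝ => (f p.1 p.2 t - M1 p.2) ^ 2 / M1 p.2) (BGK.bx.prod volume) := by
      intro t ht
      rw [← BGK.box_eq]
      exact hsq t ht
    obtain ⟨g, S, hae⟩ := BGK.exists_sol hper hdx hdt hintg hsq'
    rw [BGK.ent_eq (S.nice ht).meas (hae t ht), BGK.ent_eq (S.nice le_rfl).meas (hae 0 le_rfl)]
    exact S.decay (BGK.norm_zero (h := fun x v => f x v 0) (S.nice le_rfl) (hae 0 le_rfl) h1) ht
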